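/- (Reducibility of bipartite and tripartite Schläfli sixes) Let {L₁,…,L₆} be a real Schläfli six such that every 5-element subconfiguration has signature of absolute value 2 or 4 (i.e., the Schläfli six is bipartite or tripartite). Then the configuration is reducible: there exist indices i≠j and a continuous family (L₁(t),…,L₆(t)), t∈[0,1], of 6-tuples of lines with Lₖ(0)=Lₖ for all k, the lines pairwise skew for every t∈[0,1), and at t=1 the lines Lᵢ(1)=Lⱼ(1) coincide while the resulting five distinct lines are pairwise skew. -/

import Mathlib

open Submodule

abbrev V4 : Type := Fin 4 → ℝ

abbrev PLine : Type := Submodule ℝ V4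

def IsLine (P : PLine) : Prop := Module.finrank ℝ P = 2

def Skew (P Q : PLine) : Prop := IsLine P ∧ IsLine Q ∧ P ⊓ Q = ⊥

def PairwiseSkew {n : ℕ} (L : Fin n → PLine) : Prop :=
  ∀ i j : Fin n, i ≠ j → Skew (L i) (L j)

noncomputable def det2 (a b c d : V4) : ℝ := Matrix.det (Matrix.of ![a, b, c, d])

open Classical in
noncomputable def lk (P Q R : PLine) : ℝ :=
  if h : ∃ v : Fin 6 → V4,
      P = span ℝ {v 0, v 1} ∧ Q = span ℝ {v 2, v 3} ∧ R = span ℝ {v 4, v 5} then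
    Real.sign (det2 (h.choose 0) (h.choose 1) (h.choose 2) (h.choose 3) *
      det2 (h.choose 0) (h.choose 1) (h.choose 4) (h.choose 5) *
      det2 (h.choose 2) (h.choose 3) (h.choose 4) (h.choose 5))
  else 0

noncomputable def sgnOf {n : ℕ} (L : Fin n → PLine) : ℝ :=
  ∑ i : Fin n, ∑ j : Fin n, ∑ k : Fin n,
    if i < j ∧ j < k then lk (L i) (L j) (L k) else 0

def ContinuousLineFamily (L : ℝ → PLine) : Prop :=
  ∃ v w : ℝ → V4, ContinuousOn v (Set.Icc 0 1) ∧ ContinuousOn w (Set.Icc 0 1) ∧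
    ∀ t ∈ Set.Icc (0:ℝ) 1, L t = span ℝ {v t, w t}

def Deformation {n : ℕ} (L L' : Fin n → PLine) : Prop :=
  ∃ F : ℝ → Fin n → PLine,
    (∀ i, ContinuousLineFamily (fun t => F t i)) ∧
    (∀ t ∈ Set.Icc (0:ℝ) 1, PairwiseSkew (F t)) ∧
    F 0 = L ∧ F 1 = L'

def DeformEquiv {n : ℕ} (L L' : Fin n → PLine) : Prop :=
  ∃ π π' : Equiv.Perm (Fin n), Deformation (L ∘ π) (L' ∘ π')

def IsMirror {n : ℕ} (L L' : Fin n → PLine) : Prop :=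
  ∃ A : V4 →ₗ[ℝ] V4, LinearMap.det A < 0 ∧ ∀ i, L' i = (L i).map A

def CoarseDeformEquiv {n : ℕ} (L L' : Fin n → PLine) : Prop :=
  DeformEquiv L L' ∨ ∃ M : Fin n → PLine, IsMirror L' M ∧ DeformEquiv L M

noncomputable def joinConfig {n : ℕ} (σ : Equiv.Perm (Fin n)) : Fin n → PLine :=
  fun i => span ℝ {![1, (i.val : ℝ) + 1, 0, 0], ![0, 0, ((σ i).val : ℝ) + 1, 1]}

def IsSchlafliSix (L : Fin 6 → PLine) : Prop :=
  PairwiseSkew L ∧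
  ∃ F : MvPolynomial (Fin 4) ℝ,
    F ≠ 0 ∧ F.IsHomogeneous 3 ∧
    (∀ i : Fin 6, ∀ x ∈ L i, MvPolynomial.eval x F = 0) ∧
    (∀ z : Fin 4 → ℂ, z ≠ 0 →
      MvPolynomial.eval z (MvPolynomial.map (algebraMap ℝ ℂ) F) = 0 →
      ∃ j : Fin 4, MvPolynomial.eval z (MvPolynomial.map (algebraMap ℝ ℂ) (MvPolynomial.pderiv j F)) ≠ 0)

def Reducible {n : ℕ} (L : Fin n → PLine) : Prop :=
  ∃ i j : Fin n, i ≠ j ∧ ∃ F : ℝ → Fin n → PLine,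
    (∀ k, ContinuousLineFamily (fun t => F t k)) ∧
    F 0 = L ∧
    (∀ t ∈ Set.Ico (0:ℝ) 1, PairwiseSkew (F t)) ∧
    F 1 i = F 1 j ∧
    (∀ k l : Fin n, k ≠ l → ¬(k = i ∧ l = j) → ¬(k = j ∧ l = i) → Skew (F 1 k) (F 1 l))

lemma det2_vecMul (M : Matrix (Fin 4) (Fin 4) ℝ) (a b c d : V4) :
    det2 (Matrix.vecMul a M) (Matrix.vecMul b M) (Matrix.vecMul c M) (Matrix.vecMul d M) =
      det2 a b c d * M.det := by
  unfold det2
  rw [← Matrix.det_mul]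
  congr 1
  ext i j
  fin_cases i <;> rfl

lemma det2_explicit (a b c d : V4) : det2 a b c d =
    (a 0 * b 1 - a 1 * b 0) * (c 2 * d 3 - c 3 * d 2)
    - (a 0 * b 2 - a 2 * b 0) * (c 1 * d 3 - c 3 * d 1)
    + (a 0 * b 3 - a 3 * b 0) * (c 1 * d 2 - c 2 * d 1)
    + (a 1 * b 2 - a 2 * b 1) * (c 0 * d 3 - c 3 * d 0)
    - (a 1 * b 3 - a 3 * b 1) * (c 0 * d 2 - c 2 * d 0)
    + (a 2 * b 3 - a 3 * b 2) * (c 0 * d 1 - c 1 * d 0) := by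
  simp [det2, Matrix.det_succ_row_zero, Fin.sum_univ_succ, Fin.succAbove, Matrix.submatrix]
  ring

lemma det2_pair_comm (a b c d : V4) : det2 c d a b = det2 a b c d := by
  rw [det2_explicit, det2_explicit]; ring

lemma vecMul_of_four (a b c d x : V4) :
    Matrix.vecMul x (Matrix.of ![a, b, c, d]) = x 0 • a + x 1 • b + x 2 • c + x 3 • d := by
  ext j
  simp [Matrix.vecMul, dotProduct, Fin.sum_univ_four]

lemma four_coords_eq_zero {a b c d : V4} (h : det2 a b c d ≠ 0) {x y z w : ℝ}
    (e : x • a + y • b + z • c + w • d = 0) : x = 0 ∧ y = 0 ∧ z = 0 ∧ w = 0 := by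
  by_contra hn
  apply h
  unfold det2
  rw [← Matrix.exists_vecMul_eq_zero_iff]
  refine ⟨![x, y, z, w], ?_, ?_⟩
  · intro h0
    apply hn
    have := congrFun h0
    exact ⟨this 0, this 1, this 2, this 3⟩
  · rw [vecMul_of_four]; simpa using e

lemma exists_four_coords {a b c d : V4} (h : det2 a b c d ≠ 0) (v : V4) :
    ∃ x y z w : ℝ, v = x • a + y • b + z • c + w • d := by
  have hu : IsUnit (Matrix.of ![a, b, c, d]).det := isUnit_iff_ne_zero.mpr h
  have := Matrix.vecMul_vecMul v (Matrix.of ![a, b, c, d])⁻¹ (Matrix.of ![a, b, c, d])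
  rw [Matrix.nonsing_inv_mul _ hu, Matrix.vecMul_one, vecMul_of_four] at this
  exact ⟨_, _, _, _, this.symm⟩

lemma isLine_span_pair_iff (a b : V4) :
    IsLine (span ℝ {a, b}) ↔ ∀ x y : ℝ, x • a + y • b = 0 → x = 0 ∧ y = 0 := by
  have h2 : LinearIndependent ℝ ![a, b] ↔ IsLine (span ℝ {a, b}) := by
    have hr : Set.range ![a, b] = {a, b} := by ext; simp [eq_comm, or_comm]
    rw [linearIndependent_iff_card_eq_finrank_span, Set.finrank, hr]
    exact eq_comm
  rw [← h2, LinearIndependent.pair_iff]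

lemma skew_span_iff (a b c d : V4) :
    Skew (span ℝ {a, b}) (span ℝ {c, d}) ↔ det2 a b c d ≠ 0 := by
  constructor
  · rintro ⟨h1, h2, h3⟩ h0
    unfold det2 at h0
    rw [← Matrix.exists_vecMul_eq_zero_iff] at h0
    obtain ⟨x, hx, h0⟩ := h0
    rw [vecMul_of_four] at h0
    have hm : x 0 • a + x 1 • b ∈ span ℝ {a, b} ⊓ span ℝ {c, d} := by
      refine ⟨mem_span_pair.mpr ⟨_, _, rfl⟩, mem_span_pair.mpr ⟨-x 2, -x 3, ?_⟩⟩
      linear_combination (norm := module) -h0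
    rw [h3, mem_bot] at hm
    rw [hm, zero_add] at h0
    have e1 := (isLine_span_pair_iff a b).mp h1 _ _ hm
    have e2 := (isLine_span_pair_iff c d).mp h2 _ _ h0
    apply hx
    ext i
    fin_cases i
    exacts [e1.1, e1.2, e2.1, e2.2]
  · intro h
    refine ⟨(isLine_span_pair_iff a b).mpr fun x y e => ?_,
      (isLine_span_pair_iff c d).mpr fun x y e => ?_, ?_⟩
    · have := four_coords_eq_zero h (x := x) (y := y) (z := 0) (w := 0) (by simpa using e)
      exact ⟨this.1, this.2.1⟩
    · have := four_coords_eq_zero h (x := 0) (y := 0) (z := x) (w := y) (by simpa using e)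
      exact this.2.2
    · rw [eq_bot_iff]
      rintro v ⟨h1, h2⟩
      obtain ⟨x, y, rfl⟩ := mem_span_pair.mp h1
      obtain ⟨z, w, e⟩ := mem_span_pair.mp h2
      have := four_coords_eq_zero h (x := x) (y := y) (z := -z) (w := -w) (by
        rw [add_assoc, neg_smul, neg_smul, ← neg_add, e, add_neg_cancel])
      rw [mem_bot, this.1, this.2.1]; simp

lemma IsLine.exists_span {P : PLine} (h : IsLine P) : ∃ v w : V4, P = span ℝ {v, w} := by
  let b := Module.finBasisOfFinrankEq ℝ P h
  refine ⟨b 0, b 1, ?_⟩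
  have := congrArg (Submodule.map P.subtype) b.span_eq
  rw [Submodule.map_span, Submodule.map_top, range_subtype] at this
  refine this.symm.trans (congrArg _ ?_)
  ext x
  simp [Set.mem_insert_iff, eq_comm]

lemma span_pair_eq {v w v' w' : V4} {x y z t : ℝ} (h : x * t - y * z ≠ 0)
    (hv : v' = x • v + y • w) (hw : w' = z • v + t • w) :
    span ℝ {v', w'} = span ℝ {v, w} := by
  apply le_antisymm
  · rw [span_le]
    rintro u (rfl | rfl)
    · exact mem_span_pair.mpr ⟨_, _, hv.symm⟩
    · exact mem_span_pair.mpr ⟨_, _, hw.symm⟩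
  · rw [span_le]
    rintro u (rfl | rfl)
    · refine mem_span_pair.mpr ⟨t / (x * t - y * z), -y / (x * t - y * z), ?_⟩
      rw [hv, hw]
      ext i
      simp only [Pi.add_apply, Pi.smul_apply, smul_eq_mul]
      rw [div_mul_eq_mul_div, div_mul_eq_mul_div, ← add_div, div_eq_iff h]
      ring
    · refine mem_span_pair.mpr ⟨-z / (x * t - y * z), x / (x * t - y * z), ?_⟩
      rw [hv, hw]
      ext i
      simp only [Pi.add_apply, Pi.smul_apply, smul_eq_mul]
      rw [div_mul_eq_mul_div, div_mul_eq_mul_div, ← add_div, div_eq_iff h]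
      ring

lemma exists_det2_change {p q p' q' : V4} (h : span ℝ {p, q} = span ℝ {p', q'}) :
    ∃ c : ℝ, ∀ x y, det2 p q x y = c * det2 p' q' x y := by
  have hp : p ∈ span ℝ {p', q'} := h ▸ subset_span (by simp)
  have hq : q ∈ span ℝ {p', q'} := h ▸ subset_span (by simp)
  obtain ⟨a, b, rfl⟩ := mem_span_pair.mp hp
  obtain ⟨c, d, rfl⟩ := mem_span_pair.mp hq
  refine ⟨a * d - b * c, fun x y => ?_⟩
  simp only [det2_explicit, Pi.add_apply, Pi.smul_apply, smul_eq_mul]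
  ring

lemma Real.sign_sq_mul {s : ℝ} (hs : s ≠ 0) (x : ℝ) : Real.sign (s ^ 2 * x) = Real.sign x := by
  have : 0 < s ^ 2 := by positivity
  rcases lt_trichotomy x 0 with h | rfl | h
  · rw [Real.sign_of_neg h, Real.sign_of_neg (mul_neg_of_pos_of_neg this h)]
  · simp
  · rw [Real.sign_of_pos h, Real.sign_of_pos (mul_pos this h)]

lemma lk_span {p p' q q' r r' : V4} (h1 : det2 p p' q q' ≠ 0) (h2 : det2 p p' r r' ≠ 0) :
    lk (span ℝ {p, p'}) (span ℝ {q, q'}) (span ℝ {r, r'}) =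
      Real.sign (det2 p p' q q' * det2 p p' r r' * det2 q q' r r') := by
  have h : ∃ v : Fin 6 → V4, span ℝ {p, p'} = span ℝ {v 0, v 1} ∧
      span ℝ {q, q'} = span ℝ {v 2, v 3} ∧ span ℝ {r, r'} = span ℝ {v 4, v 5} :=
    ⟨![p, p', q, q', r, r'], rfl, rfl, rfl⟩
  rw [lk, dif_pos h]
  obtain ⟨e1, e2, e3⟩ := h.choose_spec
  set v := h.choose
  obtain ⟨a, ha⟩ := exists_det2_change e1
  obtain ⟨b, hb⟩ := exists_det2_change e2
  obtain ⟨c, hc⟩ := exists_det2_change e3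
  have d1 : det2 p p' q q' = a * b * det2 (v 0) (v 1) (v 2) (v 3) := by
    rw [ha, ← det2_pair_comm, hb, ← det2_pair_comm, mul_assoc]
  have d2 : det2 p p' r r' = a * c * det2 (v 0) (v 1) (v 4) (v 5) := by
    rw [ha, ← det2_pair_comm, hc, ← det2_pair_comm, mul_assoc]
  have d3 : det2 q q' r r' = b * c * det2 (v 2) (v 3) (v 4) (v 5) := by
    rw [hb, ← det2_pair_comm, hc, ← det2_pair_comm, mul_assoc]
  have hs : a * b * c ≠ 0 := by
    rintro h0
    rcases mul_eq_zero.mp h0 with h0 | h0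
    · exact h1 (by rw [d1, h0, zero_mul])
    · exact h2 (by rw [d2, h0, mul_zero, zero_mul])
  rw [← Real.sign_sq_mul hs, d1, d2, d3]
  congr 1
  ring

/-- The sum of the signs of `D i j * D i k * D j k` over the ordered triples of distinct indices
different from `r`. -/
noncomputable def tripleSum (D : Fin 6 → Fin 6 → ℝ) (r : Fin 6) : ℝ :=
  ∑ i, ∑ j, ∑ k, if (i ≠ r ∧ j ≠ r ∧ k ≠ r) ∧ i ≠ j ∧ i ≠ k ∧ j ≠ k then
    Real.sign (D i j * D i k * D j k) else 0

lemma sum_distinct_triples {n : ℕ} (g : Fin n → Fin n → Fin n → ℝ) (h1 : ∀ i j k, g j i k = g i j k)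
    (h2 : ∀ i j k, g i k j = g i j k) :
    (∑ i, ∑ j, ∑ k, if i ≠ j ∧ i ≠ k ∧ j ≠ k then g i j k else 0) =
      6 * ∑ i, ∑ j, ∑ k, if i < j ∧ j < k then g i j k else 0 := by
  have key : ∀ i j k : Fin n, (if i ≠ j ∧ i ≠ k ∧ j ≠ k then g i j k else 0) =
      (if i < j ∧ j < k then g i j k else 0) + (if i < k ∧ k < j then g i k j else 0) +
      (if j < i ∧ i < k then g j i k else 0) + (if j < k ∧ k < i then g j k i else 0) +
      (if k < i ∧ i < j then g k i j else 0) + (if k < j ∧ j < i then g k j i else 0) := by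
    intro i j k
    have e1 := h2 i j k
    have e2 := h1 i j k
    have e3 : g j k i = g i j k := by rw [h2, h1]
    have e4 : g k i j = g i j k := by rw [h1, h2]
    have e5 : g k j i = g i j k := by rw [h2, h1, h2]
    rw [e1, e2, e3, e4, e5]
    generalize g i j k = x
    simp only [Fin.ext_iff, Fin.lt_def, ne_eq]
    split_ifs <;> first | (exfalso; omega) | simp
  simp only [key, Finset.sum_add_distrib]
  set S := ∑ i, ∑ j, ∑ k, if i < j ∧ j < k then g i j k else 0 with hS
  have c1 : (∑ i, ∑ j, ∑ k, if i < k ∧ k < j then g i k j else 0) = S := by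
    rw [hS]; exact Finset.sum_congr rfl fun i _ => Finset.sum_comm
  have c2 : (∑ i, ∑ j, ∑ k, if j < i ∧ i < k then g j i k else 0) = S := by
    rw [Finset.sum_comm]
  have c3 : (∑ i, ∑ j, ∑ k, if j < k ∧ k < i then g j k i else 0) = S := by
    rw [Finset.sum_comm, hS]; exact Finset.sum_congr rfl fun i _ => Finset.sum_comm
  have c4 : (∑ i, ∑ j, ∑ k, if k < i ∧ i < j then g k i j else 0) = S := by
    rw [← c2]
    exact Finset.sum_congr rfl fun i _ => Finset.sum_comm
  have c5 : (∑ i, ∑ j, ∑ k, if k < j ∧ j < i then g k j i else 0) = S := by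
    rw [← c3]
    exact Finset.sum_congr rfl fun i _ => Finset.sum_comm
  rw [c1, c2, c3, c4, c5]
  ring

lemma tripleSum_eq_sgnOf {v w : Fin 6 → V4}
    (hd : ∀ i j, i ≠ j → det2 (v i) (w i) (v j) (w j) ≠ 0) (r : Fin 6) :
    tripleSum (fun i j => det2 (v i) (w i) (v j) (w j)) r =
      6 * sgnOf ((fun i => span ℝ {v i, w i}) ∘ r.succAbove) := by
  unfold tripleSum sgnOf
  have h5 := sum_distinct_triples (fun i j k =>
    Real.sign (det2 (v (r.succAbove i)) (w (r.succAbove i)) (v (r.succAbove j)) (w (r.succAbove j))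
      * det2 (v (r.succAbove i)) (w (r.succAbove i)) (v (r.succAbove k)) (w (r.succAbove k))
      * det2 (v (r.succAbove j)) (w (r.succAbove j)) (v (r.succAbove k)) (w (r.succAbove k))))
    (fun i j k => by
      rw [det2_pair_comm (v (r.succAbove i)) _ (v (r.succAbove j))]; congr 1; ring)
    (fun i j k => by
      rw [det2_pair_comm (v (r.succAbove j)) _ (v (r.succAbove k))]; congr 1; ring)
  have hne : ∀ a b c : Fin 6, a ≠ r ∧ b ≠ r ∧ c ≠ r ↔ ¬ (a = r ∨ b = r ∨ c = r) := by
    intro a b c; tauto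
  simp only [Fin.sum_univ_succAbove _ r, ne_eq, not_true_eq_false, false_and, and_false, if_false,
    Finset.sum_const_zero, zero_add, Fin.succAbove_ne, not_false_eq_true, true_and, and_true,
    Fin.succAbove_right_inj, Fin.succAbove_ne]
  simp only [ne_eq] at h5
  rw [h5]
  congr 1
  refine Finset.sum_congr rfl fun i _ => Finset.sum_congr rfl fun j _ =>
    Finset.sum_congr rfl fun k _ => ?_
  split_ifs with h
  · exact (lk_span (hd _ _ (by simpa using h.1.ne)) (hd _ _ (by simpa using (h.1.trans h.2).ne))).symm
  · rfl

lemma tripleSum_comp_perm (D : Fin 6 → Fin 6 → ℝ) (σ : Equiv.Perm (Fin 6)) (r : Fin 6) :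
    tripleSum (fun i j => D (σ i) (σ j)) r = tripleSum D (σ r) := by
  unfold tripleSum
  refine Fintype.sum_equiv σ _ _ fun i => ?_
  refine Fintype.sum_equiv σ _ _ fun j => ?_
  refine Fintype.sum_equiv σ _ _ fun k => ?_
  simp only [ne_eq, EmbeddingLike.apply_eq_iff_eq]

lemma Reducible.of_comp_perm {L : Fin 6 → PLine} (σ : Equiv.Perm (Fin 6))
    (h : Reducible (L ∘ σ)) : Reducible L := by
  obtain ⟨i, j, hij, F, hc, h0, hs, h1, hs1⟩ := h
  refine ⟨σ i, σ j, σ.injective.ne hij, fun t k => F t (σ.symm k), fun k => hc _, ?_, ?_, ?_, ?_⟩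
  · ext1 k; simp [h0]
  · intro t ht k l hkl
    exact hs t ht _ _ (σ.symm.injective.ne hkl)
  · simpa using h1
  · intro k l hkl a b
    apply hs1 _ _ (σ.symm.injective.ne hkl)
    · rwa [Equiv.symm_apply_eq, Equiv.symm_apply_eq]
    · rwa [Equiv.symm_apply_eq, Equiv.symm_apply_eq]

/-- Moving the line `k` to the line `j` along a segment, all other lines being fixed. -/
lemma reducible_of_merge {v w : Fin 6 → V4} {j k : Fin 6} (hjk : j ≠ k) (v' w' : V4)
    (hv' : span ℝ {v', w'} = span ℝ {v j, w j})
    (hd : ∀ i l, i ≠ l → det2 (v i) (w i) (v l) (w l) ≠ 0)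
    (hl : ∀ l, l ≠ j → l ≠ k → ∀ t ∈ Set.Icc (0 : ℝ) 1,
      det2 (v l) (w l) ((1 - t) • v k + t • v') ((1 - t) • w k + t • w') ≠ 0)
    (hj : ∀ t ∈ Set.Ico (0 : ℝ) 1,
      det2 (v j) (w j) ((1 - t) • v k + t • v') ((1 - t) • w k + t • w') ≠ 0) :
    Reducible (fun i => span ℝ {v i, w i}) := by
  let V : ℝ → Fin 6 → V4 := fun t => Function.update v k ((1 - t) • v k + t • v')
  let W : ℝ → Fin 6 → V4 := fun t => Function.update w k ((1 - t) • w k + t • w')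
  have hVk : ∀ t, V t k = (1 - t) • v k + t • v' := fun t => Function.update_self ..
  have hWk : ∀ t, W t k = (1 - t) • w k + t • w' := fun t => Function.update_self ..
  have hV : ∀ t i, i ≠ k → V t i = v i := fun t i h => Function.update_of_ne h ..
  have hW : ∀ t i, i ≠ k → W t i = w i := fun t i h => Function.update_of_ne h ..
  have hskew : ∀ t ∈ Set.Icc (0 : ℝ) 1, ∀ i l, i ≠ l → (i ≠ k → l = k → i = j → t ≠ 1) →
      (l ≠ k → i = k → l = j → t ≠ 1) →
      Skew (span ℝ {V t i, W t i}) (span ℝ {V t l, W t l}) := by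
    intro t ht i l hil h1 h2
    rw [skew_span_iff]
    by_cases hi : i = k
    · subst hi
      rw [hVk, hWk, hV _ _ hil.symm, hW _ _ hil.symm, ← det2_pair_comm]
      by_cases hlj : l = j
      · subst hlj
        exact hj t ⟨ht.1, lt_of_le_of_ne ht.2 (h2 hil.symm rfl rfl)⟩
      · exact hl l hlj hil.symm t ht
    · by_cases hlk : l = k
      · subst hlk
        rw [hVk, hWk, hV _ _ hil, hW _ _ hil]
        by_cases hlj : i = j
        · subst hlj
          exact hj t ⟨ht.1, lt_of_le_of_ne ht.2 (h1 hil rfl rfl)⟩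
        · exact hl i hlj hil t ht
      · rw [hV _ _ hi, hW _ _ hi, hV _ _ hlk, hW _ _ hlk]
        exact hd i l hil
  refine ⟨j, k, hjk, fun t i => span ℝ {V t i, W t i}, fun i => ⟨fun t => V t i, fun t => W t i,
    ?_, ?_, fun t _ => rfl⟩, ?_, ?_, ?_, ?_⟩
  · apply Continuous.continuousOn
    by_cases hi : i = k
    · subst hi; simp only [hVk]; fun_prop
    · simp only [hV _ _ hi]; fun_prop
  · apply Continuous.continuousOn
    by_cases hi : i = k
    · subst hi; simp only [hWk]; fun_prop
    · simp only [hW _ _ hi]; fun_prop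
  · ext1 i
    simp [V, W]
  · intro t ht i l hil
    exact hskew t ⟨ht.1, ht.2.le⟩ i l hil (fun _ _ _ => ht.2.ne) (fun _ _ _ => ht.2.ne)
  · simp only [hVk, hWk, hV _ _ hjk, hW _ _ hjk]
    simp [hv']
  · intro i l hil h1 h2
    refine hskew 1 (by simp) i l hil ?_ ?_ <;> tauto

lemma MvPolynomial.pderiv_pderiv_comm {σ R : Type*} [CommRing R] (i j : σ) (F : MvPolynomial σ R) :
    MvPolynomial.pderiv i (MvPolynomial.pderiv j F) =
      MvPolynomial.pderiv j (MvPolynomial.pderiv i F) := by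
  classical
  have h : ⁅MvPolynomial.pderiv (R := R) i, MvPolynomial.pderiv (R := R) j⁆ = 0 := by
    apply MvPolynomial.derivation_ext
    intro k
    rw [Derivation.commutator_apply]
    simp only [MvPolynomial.pderiv_X, Pi.single_apply]
    split_ifs <;> simp
  have h2 := congrArg (fun D : Derivation R (MvPolynomial σ R) (MvPolynomial σ R) => D F) h
  simp only [Derivation.commutator_apply, Derivation.zero_apply] at h2
  exact sub_eq_zero.mp h2

lemma MvPolynomial.IsHomogeneous.sum_mul_eval_pderiv {F : MvPolynomial (Fin 4) ℝ} {n : ℕ}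
    (hF : F.IsHomogeneous n) (z : V4) :
    ∑ i, z i * MvPolynomial.eval z (MvPolynomial.pderiv i F) = n * MvPolynomial.eval z F := by
  have := congrArg (MvPolynomial.eval z) hF.sum_X_mul_pderiv
  simpa using this

/-- The trilinear form with the given coefficients. -/
noncomputable def trilinearOfCoeff (c : Fin 4 → Fin 4 → Fin 4 → ℝ) :
    V4 →ₗ[ℝ] V4 →ₗ[ℝ] V4 →ₗ[ℝ] ℝ :=
  ∑ i, ∑ j, ∑ k, c i j k • (LinearMap.proj i : V4 →ₗ[ℝ] ℝ).smulRight
    ((LinearMap.proj j : V4 →ₗ[ℝ] ℝ).smulRight (LinearMap.proj k : V4 →ₗ[ℝ] ℝ))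

lemma trilinearOfCoeff_apply (c : Fin 4 → Fin 4 → Fin 4 → ℝ) (u v w : V4) :
    trilinearOfCoeff c u v w = ∑ i, ∑ j, ∑ k, c i j k * (u i * (v j * w k)) := by
  simp [trilinearOfCoeff, LinearMap.sum_apply]

lemma MvPolynomial.IsHomogeneous.exists_trilinear {F : MvPolynomial (Fin 4) ℝ}
    (hF : F.IsHomogeneous 3) :
    ∃ T : V4 →ₗ[ℝ] V4 →ₗ[ℝ] V4 →ₗ[ℝ] ℝ, (∀ u v w, T v u w = T u v w) ∧
      (∀ u v w, T u w v = T u v w) ∧ (∀ z, T z z z = 6 * MvPolynomial.eval z F) ∧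
      ∀ z k, T z z (Pi.single k 1) = 2 * MvPolynomial.eval z (MvPolynomial.pderiv k F) := by
  let c : Fin 4 → Fin 4 → Fin 4 → ℝ := fun i j k =>
    MvPolynomial.coeff 0 (MvPolynomial.pderiv i (MvPolynomial.pderiv j (MvPolynomial.pderiv k F)))
  have hc : ∀ z i j k, MvPolynomial.eval z (MvPolynomial.pderiv i
      (MvPolynomial.pderiv j (MvPolynomial.pderiv k F))) = c i j k := by
    intro z i j k
    have h0 := ((hF.pderiv (i := k)).pderiv (i := j)).pderiv (i := i)
    rw [← MvPolynomial.totalDegree_zero_iff_isHomogeneous,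
      MvPolynomial.totalDegree_eq_zero_iff_eq_C] at h0
    rw [h0, MvPolynomial.eval_C]
  have c1 : ∀ i j k, c j i k = c i j k := fun i j k => by
    simp only [c]; rw [MvPolynomial.pderiv_pderiv_comm]
  have c2 : ∀ i j k, c i k j = c i j k := fun i j k => by
    simp only [c]; rw [MvPolynomial.pderiv_pderiv_comm k j]
  have h3 : ∀ z k, ∑ i, ∑ j, c i j k * (z i * z j) =
      2 * MvPolynomial.eval z (MvPolynomial.pderiv k F) := by
    intro z k
    have e := (hF.pderiv (i := k)).sum_mul_eval_pderiv z
    norm_num at e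
    rw [← e, Finset.sum_comm]
    refine Finset.sum_congr rfl fun j _ => ?_
    have e2 := ((hF.pderiv (i := k)).pderiv (i := j)).sum_mul_eval_pderiv z
    norm_num at e2
    rw [← e2, Finset.mul_sum]
    refine Finset.sum_congr rfl fun i _ => ?_
    rw [hc]; ring
  refine ⟨trilinearOfCoeff c, ?_, ?_, ?_, ?_⟩
  · intro u v w
    simp only [trilinearOfCoeff_apply]
    rw [Finset.sum_comm]
    refine Finset.sum_congr rfl fun i _ => Finset.sum_congr rfl fun j _ =>
      Finset.sum_congr rfl fun k _ => ?_
    rw [c1]; ring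
  · intro u v w
    simp only [trilinearOfCoeff_apply]
    refine Finset.sum_congr rfl fun i _ => ?_
    rw [Finset.sum_comm]
    refine Finset.sum_congr rfl fun j _ => Finset.sum_congr rfl fun k _ => ?_
    rw [c2]; ring
  · intro z
    have e := hF.sum_mul_eval_pderiv z
    norm_num at e
    have e6 : 6 * MvPolynomial.eval z F = 2 * (3 * MvPolynomial.eval z F) := by ring
    rw [e6, ← e, trilinearOfCoeff_apply, Finset.mul_sum]
    have : ∀ i j k, c i j k * (z i * (z j * z k)) = c j k i * (z j * z k) * z i := by
      intro i j k
      rw [c2 j i k, c1]; ring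
    simp only [this, ← Finset.sum_mul]
    refine Finset.sum_congr rfl fun i _ => ?_
    rw [h3]; ring
  · intro z k
    rw [trilinearOfCoeff_apply, ← h3]
    refine Finset.sum_congr rfl fun i _ => Finset.sum_congr rfl fun j _ => ?_
    rw [Finset.sum_eq_single k]
    · simp
    · intro l _ hl; simp [hl]
    · simp

/-- A symmetric trilinear form whose cubic vanishes on the given lines and is smooth at real
points. -/
structure IsSmoothCubicForm (T : V4 →ₗ[ℝ] V4 →ₗ[ℝ] V4 →ₗ[ℝ] ℝ) : Prop where
  comm₁ : ∀ u v w, T v u w = T u v w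
  comm₂ : ∀ u v w, T u w v = T u v w
  smooth : ∀ z, (∀ v, T z z v = 0) → z = 0

lemma IsSchlafliSix.exists_form {L : Fin 6 → PLine} (hL : IsSchlafliSix L) :
    ∃ T, IsSmoothCubicForm T ∧ ∀ i, ∀ u ∈ L i, ∀ v ∈ L i, ∀ w ∈ L i, T u v w = 0 := by
  obtain ⟨_, F, _, hF, hv, hs⟩ := hL
  obtain ⟨T, t1, t2, t3, t4⟩ := hF.exists_trilinear
  refine ⟨T, ⟨t1, t2, fun z hz => ?_⟩, ?_⟩
  · by_contra hz0
    have hm : ∀ G : MvPolynomial (Fin 4) ℝ, MvPolynomial.eval (fun i => (z i : ℂ))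
        (MvPolynomial.map (algebraMap ℝ ℂ) G) = ((MvPolynomial.eval z G : ℝ) : ℂ) := by
      intro G
      rw [MvPolynomial.eval_map]
      exact (MvPolynomial.eval₂_comp (algebraMap ℝ ℂ) z G).symm
    obtain ⟨j, hj⟩ := hs (fun i => (z i : ℂ)) (fun h => hz0 (by
      ext i; simpa using congrFun h i)) (by
        rw [hm]
        have := t3 z
        rw [hz z] at this
        have h0 : MvPolynomial.eval z F = 0 := by linarith
        simp [h0])
    apply hj
    rw [hm]
    have := t4 z j
    rw [hz] at this
    have h0 : MvPolynomial.eval z (MvPolynomial.pderiv j F) = 0 := by linarith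
    simp [h0]
  · intro i u hu v hv' w hw
    have hz : ∀ z ∈ L i, T z z z = 0 := fun z hz => by rw [t3, hv i z hz, mul_zero]
    have polar : ∀ u ∈ L i, ∀ v ∈ L i, T u u v = 0 := by
      intro u hu v hv
      have e1 := hz _ ((L i).add_mem hu hv)
      have e2 := hz _ ((L i).sub_mem hu hv)
      have e3 := hz _ hu
      have e4 := hz _ hv
      simp only [map_add, map_sub, LinearMap.add_apply, LinearMap.sub_apply] at e1 e2
      have a1 := t2 u u v
      have a2 := t1 u v u
      have a3 := t2 v u v
      have a4 := t1 u v v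
      linarith
    have e1 := polar _ ((L i).add_mem hu hv') w hw
    have e2 := polar _ hu _ hw
    have e3 := polar _ hv' _ hw
    simp only [map_add, LinearMap.add_apply] at e1
    have := t1 u v w
    linarith

lemma exists_quadratic_factor_of_ne_zero {a b c d G1 G2 G3 G4 G5 G6 K1 K2 K3 K4 K5 K6 : ℝ}
    (hc : c ≠ 0) (hA : a * d - b * c ≠ 0) (hA1 : (1 - a) * (1 - d) - b * c ≠ 0)
    (e0 : G1 + K1 = 0) (e1 : G2 + 2 * G3 + K2 + 2 * K3 = 0)
    (e2 : 2 * G4 + G5 + 2 * K4 + K5 = 0) (e3 : G6 + K6 = 0)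
    (E0 : a * G1 + c * G2 + a ^ 2 * K1 + 2 * a * c * K3 + c ^ 2 * K5 = 0)
    (E1 : b * G1 + 2 * a * G3 + d * G2 + 2 * c * G4 + a ^ 2 * K2 + 2 * a * b * K1 +
      2 * a * c * K4 + 2 * (a * d + b * c) * K3 + c ^ 2 * K6 + 2 * c * d * K5 = 0)
    (E2 : 2 * b * G3 + a * G5 + 2 * d * G4 + c * G6 + b ^ 2 * K1 + 2 * a * b * K2 +
      2 * b * d * K3 + 2 * (a * d + b * c) * K4 + d ^ 2 * K5 + 2 * c * d * K6 = 0)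
    (E3 : b * G5 + d * G6 + b ^ 2 * K2 + 2 * b * d * K4 + d ^ 2 * K6 = 0) :
    ∃ m n : ℝ, G1 = c * m ∧ G2 + 2 * G3 = c * n + (d - a) * m ∧
      2 * G4 + G5 = (d - a) * n - b * m ∧ G6 = -b * n := by
  obtain rfl : K1 = -G1 := by linarith
  obtain rfl : K6 = -G6 := by linarith
  obtain rfl : K2 = -(G2 + 2 * G3) - 2 * K3 := by linarith
  obtain rfl : K5 = -(2 * G4 + G5) - 2 * K4 := by linarith
  have hm : (a * d - b * c) * ((1 - a) * (1 - d) - b * c) * c ≠ 0 :=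
    mul_ne_zero (mul_ne_zero hA hA1) hc
  have r1 : G1 * ((a - d) ^ 2 + b * c) + (G2 + 2 * G3) * c * (a - d) + (2 * G4 + G5) * c ^ 2 = 0 := by
    refine (mul_eq_zero.mp ?_).resolve_left hm
    linear_combination (c * (a * (1 - a) - b * c) * ((a - d) ^ 2 + b * c) +
        c * (a + d - 1) * ((a - d) ^ 3 + 2 * b * c * (a - d))) * E0 +
      (c ^ 2 * (a * (1 - a) - b * c) * (a - d) + c ^ 2 * (a + d - 1) * ((a - d) ^ 2 + b * c)) * E1 +
      (c ^ 3 * (a * (1 - a) - b * c) + c ^ 3 * (a + d - 1) * (a - d)) * E2 +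
      c ^ 4 * (a + d - 1) * E3
  have r0 : G1 * (a - d) * b + (G2 + 2 * G3) * b * c + G6 * c ^ 2 = 0 := by
    refine (mul_eq_zero.mp ?_).resolve_left hm
    linear_combination (c * (a * (1 - a) - b * c) * ((a - d) * b) +
        c * (a + d - 1) * (b * ((a - d) ^ 2 + b * c))) * E0 +
      (c ^ 2 * (a * (1 - a) - b * c) * b + c ^ 2 * (a + d - 1) * (b * (a - d))) * E1 +
      (c ^ 3 * (a + d - 1) * b) * E2 + c ^ 3 * (a * (1 - a) - b * c) * E3
  refine ⟨G1 / c, (G2 + 2 * G3 - (d - a) * (G1 / c)) / c, ?_, ?_, ?_, ?_⟩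
  · field_simp
  · field_simp; ring
  · field_simp; linear_combination r1
  · field_simp; linear_combination r0

lemma exists_quadratic_factor {a b c d G1 G2 G3 G4 G5 G6 K1 K2 K3 K4 K5 K6 : ℝ}
    (hA : a * d - b * c ≠ 0) (hA1 : (1 - a) * (1 - d) - b * c ≠ 0)
    (e0 : G1 + K1 = 0) (e1 : G2 + 2 * G3 + K2 + 2 * K3 = 0)
    (e2 : 2 * G4 + G5 + 2 * K4 + K5 = 0) (e3 : G6 + K6 = 0)
    (E0 : a * G1 + c * G2 + a ^ 2 * K1 + 2 * a * c * K3 + c ^ 2 * K5 = 0)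
    (E1 : b * G1 + 2 * a * G3 + d * G2 + 2 * c * G4 + a ^ 2 * K2 + 2 * a * b * K1 +
      2 * a * c * K4 + 2 * (a * d + b * c) * K3 + c ^ 2 * K6 + 2 * c * d * K5 = 0)
    (E2 : 2 * b * G3 + a * G5 + 2 * d * G4 + c * G6 + b ^ 2 * K1 + 2 * a * b * K2 +
      2 * b * d * K3 + 2 * (a * d + b * c) * K4 + d ^ 2 * K5 + 2 * c * d * K6 = 0)
    (E3 : b * G5 + d * G6 + b ^ 2 * K2 + 2 * b * d * K4 + d ^ 2 * K6 = 0) :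
    ∃ m n : ℝ, G1 = c * m ∧ G2 + 2 * G3 = c * n + (d - a) * m ∧
      2 * G4 + G5 = (d - a) * n - b * m ∧ G6 = -b * n := by
  by_cases hc : c = 0
  swap
  · exact exists_quadratic_factor_of_ne_zero hc hA hA1 e0 e1 e2 e3 E0 E1 E2 E3
  by_cases hb : b = 0
  swap
  · obtain ⟨m, n, h1, h2, h3, h4⟩ := exists_quadratic_factor_of_ne_zero (a := d) (b := c) (c := b)
      (d := a) (G1 := G6) (G2 := G5) (G3 := G4) (G4 := G3) (G5 := G2) (G6 := G1)
      (K1 := K6) (K2 := K5) (K3 := K4) (K4 := K3) (K5 := K2) (K6 := K1) hb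
      (by convert hA using 1; ring) (by convert hA1 using 1; ring) e3 (by linarith) (by linarith) e0
      (by linarith) (by linarith) (by linarith) (by linarith)
    exact ⟨-n, -m, by linarith, by linarith, by linarith, by linarith⟩
  subst hb hc
  simp only [mul_zero, sub_zero, zero_mul, zero_add, add_zero, ne_eq, zero_pow two_ne_zero,
    mul_eq_zero, not_or] at *
  have h0 : G1 = 0 := by
    refine (mul_eq_zero.mp ?_).resolve_left (mul_ne_zero hA.1 hA1.1)
    linear_combination E0 - a ^ 2 * e0
  have h3 : G6 = 0 := by
    refine (mul_eq_zero.mp ?_).resolve_left (mul_ne_zero hA.2 hA1.2)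
    linear_combination E3 - d ^ 2 * e3
  by_cases had : a = d
  · subst had
    have h1 : G2 + 2 * G3 = 0 := by
      refine (mul_eq_zero.mp ?_).resolve_left (mul_ne_zero hA.1 hA1.1)
      linear_combination E1 - a ^ 2 * e1
    have h2 : 2 * G4 + G5 = 0 := by
      refine (mul_eq_zero.mp ?_).resolve_left (mul_ne_zero hA.2 hA1.2)
      linear_combination E2 - a ^ 2 * e2
    exact ⟨0, 0, by simp [h0], by simp [h1], by simp [h2], by simp [h3]⟩
  · have hda : d - a ≠ 0 := sub_ne_zero.mpr (Ne.symm had)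
    refine ⟨(G2 + 2 * G3) / (d - a), (2 * G4 + G5) / (d - a), h0, ?_, ?_, by linarith⟩
    · field_simp
    · field_simp

lemma exists_two_roots {α β γ : ℝ} (h : 0 < β ^ 2 - 4 * α * γ) :
    ∃ x y x' y' : ℝ, x * y' - x' * y ≠ 0 ∧ α * x ^ 2 + β * x * y + γ * y ^ 2 = 0 ∧
      α * x' ^ 2 + β * x' * y' + γ * y' ^ 2 = 0 := by
  by_cases hα : α = 0
  · subst hα
    refine ⟨1, 0, -γ, β, ?_, by ring, by ring⟩
    rintro h0
    have : β = 0 := by linarith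
    subst this
    simp at h
  · have hs := Real.sq_sqrt h.le
    have hs0 := (Real.sqrt_pos.mpr h).ne'
    set s := √(β ^ 2 - 4 * α * γ)
    refine ⟨-β + s, 2 * α, -β - s, 2 * α, ?_, ?_, ?_⟩
    · have : (-β + s) * (2 * α) - (-β - s) * (2 * α) = 4 * s * α := by ring
      rw [this]
      positivity
    · linear_combination α * hs
    · linear_combination α * hs

lemma eq_zero_of_disc_neg {α β γ x y : ℝ} (h : β ^ 2 - 4 * α * γ < 0)
    (e : α * x ^ 2 + β * x * y + γ * y ^ 2 = 0) : x = 0 ∧ y = 0 := by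
  have hy : y = 0 := by
    by_contra hy
    have : 0 < y ^ 2 := by positivity
    have e4 : (2 * α * x + β * y) ^ 2 = (β ^ 2 - 4 * α * γ) * y ^ 2 := by
      linear_combination 4 * α * e
    exact (mul_neg_of_neg_of_pos h this).not_ge (e4 ▸ sq_nonneg _)
  subst hy
  refine ⟨?_, rfl⟩
  by_contra hx
  have : 0 < x ^ 2 := by positivity
  have hα : α = 0 := by
    have : α * x ^ 2 = 0 := by linarith
    simpa [hx] using this
  subst hα
  nlinarith [sq_nonneg β]

/-- A binary cubic form whose two partial derivatives have no common real zero. -/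
def NoDoubleRoot (h0 h1 h2 h3 : ℝ) : Prop :=
  ∀ x y : ℝ, 3 * h0 * x ^ 2 + 2 * h1 * x * y + h2 * y ^ 2 = 0 →
    h1 * x ^ 2 + 2 * h2 * x * y + 3 * h3 * y ^ 2 = 0 → x = 0 ∧ y = 0

lemma NoDoubleRoot.disc_ne_zero {α β γ m n h0 h1 h2 h3 : ℝ} (h : NoDoubleRoot h0 h1 h2 h3)
    (e0 : h0 = α * m) (e1 : h1 = α * n + β * m) (e2 : h2 = β * n + γ * m) (e3 : h3 = γ * n) :
    β ^ 2 - 4 * α * γ ≠ 0 := by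
  intro hd
  subst e0 e1 e2 e3
  by_cases hα : α = 0
  · subst hα
    have hβ : β = 0 := by simpa using hd
    subst hβ
    have := h 1 0 (by ring) (by ring)
    exact one_ne_zero this.1
  · have := h (-β) (2 * α) (by linear_combination (-α * m) * hd)
      (by linear_combination (β * m - 3 * α * n) * hd)
    exact hα (by linarith [this.2])

lemma NoDoubleRoot.factor_ne_zero {α β γ m n h0 h1 h2 h3 : ℝ} (h : NoDoubleRoot h0 h1 h2 h3)
    (e0 : h0 = α * m) (e1 : h1 = α * n + β * m) (e2 : h2 = β * n + γ * m) (e3 : h3 = γ * n) :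
    ¬ (m = 0 ∧ n = 0) := by
  rintro ⟨rfl, rfl⟩
  subst e0 e1 e2 e3
  have := h 1 0 (by ring) (by ring)
  exact one_ne_zero this.1

lemma NoDoubleRoot.common_root {α β γ m n α' β' γ' m' n' h0 h1 h2 h3 : ℝ}
    (h : NoDoubleRoot h0 h1 h2 h3)
    (e0 : h0 = α * m) (e1 : h1 = α * n + β * m) (e2 : h2 = β * n + γ * m) (e3 : h3 = γ * n)
    (e0' : h0 = α' * m') (e1' : h1 = α' * n' + β' * m') (e2' : h2 = β' * n' + γ' * m')
    (e3' : h3 = γ' * n') (hd : 0 < β ^ 2 - 4 * α * γ) :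
    ∃ x y : ℝ, ¬ (x = 0 ∧ y = 0) ∧ α * x ^ 2 + β * x * y + γ * y ^ 2 = 0 ∧
      α' * x ^ 2 + β' * x * y + γ' * y ^ 2 = 0 := by
  obtain ⟨x, y, x', y', hne, r, r'⟩ := exists_two_roots hd
  have key : ∀ x y, α * x ^ 2 + β * x * y + γ * y ^ 2 = 0 →
      (α' * x ^ 2 + β' * x * y + γ' * y ^ 2) * (m' * x + n' * y) = 0 := by
    intro x y r
    subst e0 e1 e2 e3
    linear_combination (m * x + n * y) * r - x ^ 3 * e0' - x ^ 2 * y * e1' - x * y ^ 2 * e2' -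
      y ^ 3 * e3'
  rcases mul_eq_zero.mp (key x y r) with s | s
  · exact ⟨x, y, fun ⟨h1, h2⟩ => hne (by simp [h1, h2]), r, s⟩
  rcases mul_eq_zero.mp (key x' y' r') with s' | s'
  · exact ⟨x', y', fun ⟨h1, h2⟩ => hne (by simp [h1, h2]), r', s'⟩
  exfalso
  refine h.factor_ne_zero e0' e1' e2' e3' ⟨?_, ?_⟩
  · refine (mul_eq_zero.mp ?_).resolve_left hne
    linear_combination y' * s - y * s'
  · refine (mul_eq_zero.mp ?_).resolve_left hne
    linear_combination x * s' - x' * s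

lemma NoDoubleRoot.proportional {α β γ m n α' β' γ' m' n' h0 h1 h2 h3 : ℝ}
    (h : NoDoubleRoot h0 h1 h2 h3)
    (e0 : h0 = α * m) (e1 : h1 = α * n + β * m) (e2 : h2 = β * n + γ * m) (e3 : h3 = γ * n)
    (e0' : h0 = α' * m') (e1' : h1 = α' * n' + β' * m') (e2' : h2 = β' * n' + γ' * m')
    (e3' : h3 = γ' * n') (hd' : β' ^ 2 - 4 * α' * γ' < 0) :
    ∃ κ : ℝ, α = κ * α' ∧ β = κ * β' ∧ γ = κ * γ' := by
  have hmn := h.factor_ne_zero e0 e1 e2 e3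
  have hr : (α' * n ^ 2 + β' * n * (-m) + γ' * (-m) ^ 2) * (m' * n - n' * m) = 0 := by
    subst e0 e1 e2 e3
    linear_combination -n ^ 3 * e0' + n ^ 2 * m * e1' - n * m ^ 2 * e2' + m ^ 3 * e3'
  have hl : m' * n - n' * m = 0 := by
    refine (mul_eq_zero.mp hr).resolve_left fun h0 => hmn ?_
    have := eq_zero_of_disc_neg hd' h0
    exact ⟨by linarith [this.2], this.1⟩
  obtain ⟨κ, k1, k2⟩ : ∃ κ, m' = κ * m ∧ n' = κ * n := by
    by_cases hm : m = 0
    · have hn : n ≠ 0 := fun hn => hmn ⟨hm, hn⟩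
      subst hm
      refine ⟨n' / n, ?_, by field_simp⟩
      have : m' * n = 0 := by linarith
      simpa [hn] using this
    · exact ⟨m' / m, by field_simp, by field_simp; linarith⟩
  subst k1 k2
  refine ⟨κ, ?_⟩
  by_cases hm : m = 0
  · have hn : n ≠ 0 := fun hn => hmn ⟨hm, hn⟩
    subst hm
    exact ⟨mul_right_cancel₀ hn (by linarith), mul_right_cancel₀ hn (by linarith),
      mul_right_cancel₀ hn (by linarith)⟩
  · have a1 : α = κ * α' := mul_right_cancel₀ hm (by linarith)
    subst a1
    have a2 : β = κ * β' := mul_right_cancel₀ hm (by linarith)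
    subst a2
    exact ⟨rfl, rfl, mul_right_cancel₀ hm (by linarith)⟩

lemma common_root_or_det_pos {a b c d m n a' b' c' d' m' n' h0 h1 h2 h3 : ℝ}
    (h : NoDoubleRoot h0 h1 h2 h3)
    (e0 : h0 = c * m) (e1 : h1 = c * n + (d - a) * m) (e2 : h2 = (d - a) * n - b * m)
    (e3 : h3 = -b * n)
    (e0' : h0 = c' * m') (e1' : h1 = c' * n' + (d' - a') * m') (e2' : h2 = (d' - a') * n' - b' * m')
    (e3' : h3 = -b' * n') (hAB : (a - a') * (d - d') - (b - b') * (c - c') ≠ 0) :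
    (∃ x y : ℝ, ¬ (x = 0 ∧ y = 0) ∧ x * (c * x + d * y) = y * (a * x + b * y) ∧
      x * (c' * x + d' * y) = y * (a' * x + b' * y)) ∨
    (0 < a * d - b * c ∧ 0 < (1 - a) * (1 - d) - b * c ∧ 0 < a' * d' - b' * c' ∧
      0 < (1 - a') * (1 - d') - b' * c' ∧ 0 < (a - a') * (d - d') - (b - b') * (c - c')) := by
  have e2 : h2 = (d - a) * n + -b * m := by linarith
  have e2' : h2 = (d' - a') * n' + -b' * m' := by linarith
  rcases (h.disc_ne_zero e0 e1 e2 e3).symm.lt_or_gt with hA | hA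
  · obtain ⟨x, y, hxy, r, r'⟩ := h.common_root e0 e1 e2 e3 e0' e1' e2' e3' hA
    exact Or.inl ⟨x, y, hxy, by linarith, by linarith⟩
  rcases (h.disc_ne_zero e0' e1' e2' e3').symm.lt_or_gt with hB | hB
  · obtain ⟨x, y, hxy, r, r'⟩ := h.common_root e0' e1' e2' e3' e0 e1 e2 e3 hB
    exact Or.inl ⟨x, y, hxy, by linarith, by linarith⟩
  right
  obtain ⟨κ, k1, k2, k3⟩ := h.proportional e0 e1 e2 e3 e0' e1' e2' e3' hB
  refine ⟨?_, ?_, ?_, ?_, lt_of_le_of_ne ?_ hAB.symm⟩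
  · nlinarith [sq_nonneg (a + d)]
  · nlinarith [sq_nonneg (2 - a - d)]
  · nlinarith [sq_nonneg (a' + d')]
  · nlinarith [sq_nonneg (2 - a' - d')]
  · obtain rfl : b = κ * b' := by linarith
    obtain rfl : d = a + κ * (d' - a') := by linarith
    subst k1
    nlinarith [sq_nonneg (2 * a - a' - d' + κ * (d' - a')), mul_nonneg (sq_nonneg (κ - 1)) (neg_nonneg.mpr hB.le)]

lemma exists_graph_basis {p1 p2 q1 q2 : V4} (h : det2 p1 p2 q1 q2 ≠ 0) {P : PLine}
    (hP : Skew (span ℝ {q1, q2}) P) : ∃ a b c d : ℝ,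
      P = span ℝ {p1 + (a • q1 + c • q2), p2 + (b • q1 + d • q2)} := by
  obtain ⟨v, w, rfl⟩ := hP.2.1.exists_span
  rw [skew_span_iff] at hP
  obtain ⟨x, y, z, t, rfl⟩ := exists_four_coords h v
  obtain ⟨x', y', z', t', rfl⟩ := exists_four_coords h w
  have hd : x * y' - y * x' ≠ 0 := by
    intro h0
    apply hP
    have : det2 q1 q2 (x • p1 + y • p2 + z • q1 + t • q2) (x' • p1 + y' • p2 + z' • q1 + t' • q2) =
        (x * y' - y * x') * det2 p1 p2 q1 q2 := by
      simp only [det2_explicit, Pi.add_apply, Pi.smul_apply, smul_eq_mul]; ring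
    rw [this, h0, zero_mul]
  set s := (x * y' - y * x')⁻¹ with hs
  have hs1 : s * (x * y' - y * x') = 1 := inv_mul_cancel₀ hd
  refine ⟨s * (y' * z - y * z'), s * (x * z' - x' * z), s * (y' * t - y * t'),
    s * (x * t' - x' * t), (span_pair_eq (x := s * y') (y := -s * y) (z := -s * x') (t := s * x)
    ?_ ?_ ?_).symm⟩
  · have : s * y' * (s * x) - -s * y * (-s * x') = s * (s * (x * y' - y * x')) := by ring
    rw [this, hs1, mul_one]
    exact inv_ne_zero hd
  · linear_combination (norm := module) -hs1 • p1
  · linear_combination (norm := module) -hs1 • p2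

lemma det2_graph (p1 p2 q1 q2 : V4) (a b c d a' b' c' d' : ℝ) :
    det2 (p1 + (a • q1 + c • q2)) (p2 + (b • q1 + d • q2))
      (p1 + (a' • q1 + c' • q2)) (p2 + (b' • q1 + d' • q2)) =
      ((a - a') * (d - d') - (b - b') * (c - c')) * det2 p1 p2 q1 q2 := by
  simp only [det2_explicit, Pi.add_apply, Pi.smul_apply, smul_eq_mul]; ring

/-- Bases of the first five lines in which three of them are in standard position. -/
lemma PairwiseSkew.exists_normal_form {L : Fin 6 → PLine} (hL : PairwiseSkew L) :
    ∃ p1 p2 q1 q2 : V4, ∃ a b c d a' b' c' d' : ℝ, det2 p1 p2 q1 q2 ≠ 0 ∧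
      L 0 = span ℝ {p1, p2} ∧ L 1 = span ℝ {q1, q2} ∧ L 2 = span ℝ {p1 + q1, p2 + q2} ∧
      L 3 = span ℝ {p1 + (a • q1 + c • q2), p2 + (b • q1 + d • q2)} ∧
      L 4 = span ℝ {p1 + (a' • q1 + c' • q2), p2 + (b' • q1 + d' • q2)} := by
  obtain ⟨p1, p2, h0⟩ := (hL 0 1 (by decide)).1.exists_span
  obtain ⟨q1, q2, h1⟩ := (hL 0 1 (by decide)).2.1.exists_span
  have h01 : det2 p1 p2 q1 q2 ≠ 0 := by
    rw [← skew_span_iff, ← h0, ← h1]; exact hL 0 1 (by decide)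
  obtain ⟨a, b, c, d, h2⟩ := exists_graph_basis h01 (h1 ▸ hL 1 2 (by decide))
  have hd : a * d - b * c ≠ 0 := by
    intro hd
    have h3 := hL 0 2 (by decide)
    rw [h0, h2, skew_span_iff] at h3
    apply h3
    have := det2_graph p1 p2 q1 q2 0 0 0 0 a b c d
    simp only [zero_smul, add_zero] at this
    rw [this]
    have : (0 - a) * (0 - d) - (0 - b) * (0 - c) = a * d - b * c := by ring
    rw [this, hd, zero_mul]
  have hdet : det2 p1 p2 (a • q1 + c • q2) (b • q1 + d • q2) ≠ 0 := by
    have : det2 p1 p2 (a • q1 + c • q2) (b • q1 + d • q2) =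
        (a * d - b * c) * det2 p1 p2 q1 q2 := by
      simp only [det2_explicit, Pi.add_apply, Pi.smul_apply, smul_eq_mul]; ring
    rw [this]; exact mul_ne_zero hd h01
  have h1' : L 1 = span ℝ {a • q1 + c • q2, b • q1 + d • q2} := by
    rw [h1]; exact (span_pair_eq (by rwa [mul_comm c b]) rfl rfl).symm
  obtain ⟨e, f, g, h, h3⟩ := exists_graph_basis hdet (h1' ▸ hL 1 3 (by decide))
  obtain ⟨e', f', g', h', h4⟩ := exists_graph_basis hdet (h1' ▸ hL 1 4 (by decide))
  exact ⟨_, _, _, _, _, _, _, _, _, _, _, _, hdet, h0, h1', h2, h3, h4⟩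

namespace IsSmoothCubicForm

lemma not_tangent {T : V4 →ₗ[ℝ] V4 →ₗ[ℝ] V4 →ₗ[ℝ] ℝ} (hT : IsSmoothCubicForm T)
    {P P' Q Q' : V4} (h : det2 P P' Q Q' ≠ 0)
    (hP : ∀ u ∈ span ℝ {P, P'}, ∀ v ∈ span ℝ {P, P'}, ∀ w ∈ span ℝ {P, P'}, T u v w = 0)
    (hQ : ∀ u ∈ span ℝ {Q, Q'}, ∀ v ∈ span ℝ {Q, Q'}, ∀ w ∈ span ℝ {Q, Q'}, T u v w = 0)
    (e1 : T P P Q = 0) (e2 : T P Q Q = 0) (e3 : 2 * T P P' Q + T P P Q' = 0)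
    (e4 : T P' Q Q + 2 * T P Q Q' = 0) : False := by
  have key : ∀ α β : ℝ, α * T P P' Q - β * T P Q Q' = 0 → α • P + β • Q = 0 := by
    intro α β hαβ
    apply hT.smooth
    intro v
    have mP : P ∈ span ℝ {P, P'} := subset_span (by simp)
    have mP' : P' ∈ span ℝ {P, P'} := subset_span (by simp)
    have mQ : Q ∈ span ℝ {Q, Q'} := subset_span (by simp)
    have mQ' : Q' ∈ span ℝ {Q, Q'} := subset_span (by simp)
    obtain ⟨x, y, z, w, rfl⟩ := exists_four_coords h v
    have a1 := hP P mP P mP P mP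
    have a2 := hP P mP P mP P' mP'
    have a3 := hQ Q mQ Q mQ Q mQ
    have a4 := hQ Q mQ Q mQ Q' mQ'
    have b1 : T P Q P = T P P Q := hT.comm₂ _ _ _
    have b2 : T Q P P = T P P Q := by rw [hT.comm₁, b1]
    have b3 : T Q P Q = T P Q Q := hT.comm₁ _ _ _
    have b4 : T Q Q P = T P Q Q := by rw [hT.comm₂, b3]
    have b5 : T P Q P' = T P P' Q := hT.comm₂ _ _ _
    have b6 : T Q P P' = T P P' Q := by rw [hT.comm₁, b5]
    have b7 : T Q P Q' = T P Q Q' := hT.comm₁ _ _ _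
    have b8 : T Q Q P' = T P' Q Q := by rw [hT.comm₂, hT.comm₁]
    simp only [map_add, map_smul, LinearMap.add_apply, LinearMap.smul_apply, smul_eq_mul,
      a1, a2, a3, a4, b1, b2, b3, b4, b5, b6, b7, b8]
    linear_combination (α * β * 2 * x + α ^ 2 * z) * e1 + (β ^ 2 * x + 2 * α * β * z) * e2 +
      α ^ 2 * w * e3 + β ^ 2 * y * e4 + (2 * β * y - 2 * α * w) * hαβ
  have coords : ∀ α β : ℝ, α • P + β • Q = 0 → α = 0 ∧ β = 0 := by
    intro α β h0
    have := four_coords_eq_zero h (x := α) (y := 0) (z := β) (w := 0) (by simpa using h0)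
    exact ⟨this.1, this.2.2.1⟩
  have h1 := coords _ _ (key (T P Q Q') (T P P' Q) (by ring))
  have h2 := coords _ _ (key 1 0 (by rw [h1.2]; ring))
  exact one_ne_zero h2.1

/-- The binary cubic `u ↦ T (X u) (X u) (Y u)` attached to three skew lines of a smooth cubic. -/
lemma noDoubleRoot {T : V4 →ₗ[ℝ] V4 →ₗ[ℝ] V4 →ₗ[ℝ] ℝ} (hT : IsSmoothCubicForm T)
    {p1 p2 q1 q2 : V4} (h : det2 p1 p2 q1 q2 ≠ 0)
    (hP : ∀ u ∈ span ℝ {p1, p2}, ∀ v ∈ span ℝ {p1, p2}, ∀ w ∈ span ℝ {p1, p2}, T u v w = 0)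
    (hQ : ∀ u ∈ span ℝ {q1, q2}, ∀ v ∈ span ℝ {q1, q2}, ∀ w ∈ span ℝ {q1, q2}, T u v w = 0)
    (e0 : T p1 p1 q1 + T q1 q1 p1 = 0)
    (e1 : T p1 p1 q2 + 2 * T p1 p2 q1 + T q1 q1 p2 + 2 * T q1 q2 p1 = 0)
    (e2 : 2 * T p1 p2 q2 + T p2 p2 q1 + 2 * T q1 q2 p2 + T q2 q2 p1 = 0)
    (e3 : T p2 p2 q2 + T q2 q2 p2 = 0) :
    NoDoubleRoot (T p1 p1 q1) (T p1 p1 q2 + 2 * T p1 p2 q1) (2 * T p1 p2 q2 + T p2 p2 q1)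
      (T p2 p2 q2) := by
  intro x y h1 h2
  by_contra hxy
  have hn : x ^ 2 + y ^ 2 ≠ 0 := by
    intro h0
    exact hxy ⟨by nlinarith [sq_nonneg x, sq_nonneg y], by nlinarith [sq_nonneg x, sq_nonneg y]⟩
  have hsp : ∀ r r' : V4, span ℝ {x • r + y • r', -y • r + x • r'} = span ℝ {r, r'} :=
    fun r r' => span_pair_eq (x := x) (y := y) (z := -y) (t := x)
      (by convert hn using 1; ring) rfl rfl
  have c1 : ∀ r, T p2 p1 r = T p1 p2 r := fun r => hT.comm₁ _ _ _
  have d1 : T q1 q1 p1 = T p1 q1 q1 := by rw [hT.comm₂, hT.comm₁]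
  have d2 : T q1 q1 p2 = T p2 q1 q1 := by rw [hT.comm₂, hT.comm₁]
  have d3 : T q1 q2 p1 = T p1 q1 q2 := by rw [hT.comm₁, hT.comm₂, hT.comm₁, hT.comm₂]
  have d4 : T q1 q2 p2 = T p2 q1 q2 := by rw [hT.comm₁, hT.comm₂, hT.comm₁, hT.comm₂]
  have d5 : T q2 q2 p1 = T p1 q2 q2 := by rw [hT.comm₂, hT.comm₁]
  have d6 : T q2 q2 p2 = T p2 q2 q2 := by rw [hT.comm₂, hT.comm₁]
  have d7 : ∀ r, T r q2 q1 = T r q1 q2 := fun r => hT.comm₂ _ _ _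
  rw [d1] at e0
  rw [d2, d3] at e1
  rw [d4, d5] at e2
  rw [d6] at e3
  refine hT.not_tangent (P := x • p1 + y • p2) (P' := -y • p1 + x • p2) (Q := x • q1 + y • q2)
    (Q' := -y • q1 + x • q2) ?_ (by rwa [hsp]) (by rwa [hsp]) ?_ ?_ ?_ ?_
  · have : det2 (x • p1 + y • p2) (-y • p1 + x • p2) (x • q1 + y • q2) (-y • q1 + x • q2) =
        (x ^ 2 + y ^ 2) ^ 2 * det2 p1 p2 q1 q2 := by
      simp only [det2_explicit, Pi.add_apply, Pi.smul_apply, smul_eq_mul]; ring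
    rw [this]
    exact mul_ne_zero (pow_ne_zero _ hn) h
  all_goals
    simp only [map_add, map_smul, LinearMap.add_apply, LinearMap.smul_apply, smul_eq_mul, c1, d7]
  · linear_combination (x * h1 + y * h2) / 3
  · linear_combination -(x * h1 + y * h2) / 3 + x ^ 3 * e0 + x ^ 2 * y * e1 + x * y ^ 2 * e2 +
      y ^ 3 * e3
  · linear_combination -y * h1 + x * h2
  · linear_combination y * h1 - x * h2 + (-3 * x ^ 2 * y) * e0 + (x ^ 3 - 2 * x * y ^ 2) * e1 +
      (2 * x ^ 2 * y - y ^ 3) * e2 + 3 * x * y ^ 2 * e3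

end IsSmoothCubicForm

/-- The cubic of `T` vanishes on the line `P`. -/
def VanishesOn (T : V4 →ₗ[ℝ] V4 →ₗ[ℝ] V4 →ₗ[ℝ] ℝ) (P : PLine) : Prop :=
  ∀ u ∈ P, ∀ v ∈ P, ∀ w ∈ P, T u v w = 0

namespace IsSmoothCubicForm

lemma graph_equations {T : V4 →ₗ[ℝ] V4 →ₗ[ℝ] V4 →ₗ[ℝ] ℝ} (hT : IsSmoothCubicForm T)
    {p1 p2 q1 q2 : V4} {a b c d : ℝ} (hP : VanishesOn T (span ℝ {p1, p2}))
    (hQ : VanishesOn T (span ℝ {q1, q2}))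
    (hR : VanishesOn T (span ℝ {p1 + (a • q1 + c • q2), p2 + (b • q1 + d • q2)})) :
    a * T p1 p1 q1 + c * T p1 p1 q2 + a ^ 2 * T q1 q1 p1 + 2 * a * c * T q1 q2 p1 +
      c ^ 2 * T q2 q2 p1 = 0 ∧
    b * T p1 p1 q1 + 2 * a * T p1 p2 q1 + d * T p1 p1 q2 + 2 * c * T p1 p2 q2 +
      a ^ 2 * T q1 q1 p2 + 2 * a * b * T q1 q1 p1 + 2 * a * c * T q1 q2 p2 +
      2 * (a * d + b * c) * T q1 q2 p1 + c ^ 2 * T q2 q2 p2 + 2 * c * d * T q2 q2 p1 = 0 ∧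
    2 * b * T p1 p2 q1 + a * T p2 p2 q1 + 2 * d * T p1 p2 q2 + c * T p2 p2 q2 +
      b ^ 2 * T q1 q1 p1 + 2 * a * b * T q1 q1 p2 + 2 * b * d * T q1 q2 p1 +
      2 * (a * d + b * c) * T q1 q2 p2 + d ^ 2 * T q2 q2 p1 + 2 * c * d * T q2 q2 p2 = 0 ∧
    b * T p2 p2 q1 + d * T p2 p2 q2 + b ^ 2 * T q1 q1 p2 + 2 * b * d * T q1 q2 p2 +
      d ^ 2 * T q2 q2 p2 = 0 := by
  have m1 : ∀ r s : V4, r ∈ span ℝ {r, s} := fun r s => subset_span (by simp)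
  have m2 : ∀ r s : V4, s ∈ span ℝ {r, s} := fun r s => subset_span (by simp)
  have c2 : ∀ r s, T q1 r s = T r q1 s := fun r s => hT.comm₁ _ _ _
  have c3 : ∀ r s, T q2 r s = T r q2 s := fun r s => hT.comm₁ _ _ _
  have c4 : ∀ r, T r q1 p1 = T r p1 q1 := fun r => hT.comm₂ _ _ _
  have c5 : ∀ r, T r q1 p2 = T r p2 q1 := fun r => hT.comm₂ _ _ _
  have c6 : ∀ r, T r q2 p1 = T r p1 q2 := fun r => hT.comm₂ _ _ _
  have c7 : ∀ r, T r q2 p2 = T r p2 q2 := fun r => hT.comm₂ _ _ _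
  have d1 : T q1 q1 p1 = T p1 q1 q1 := by rw [hT.comm₂, hT.comm₁]
  have d2 : T q1 q1 p2 = T p2 q1 q1 := by rw [hT.comm₂, hT.comm₁]
  have d3 : T q1 q2 p1 = T p1 q1 q2 := by rw [hT.comm₁, hT.comm₂, hT.comm₁, hT.comm₂]
  have d4 : T q1 q2 p2 = T p2 q1 q2 := by rw [hT.comm₁, hT.comm₂, hT.comm₁, hT.comm₂]
  have d5 : T q2 q2 p1 = T p1 q2 q2 := by rw [hT.comm₂, hT.comm₁]
  have d6 : T q2 q2 p2 = T p2 q2 q2 := by rw [hT.comm₂, hT.comm₁]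
  have d7 : ∀ r, T r q2 q1 = T r q1 q2 := fun r => hT.comm₂ _ _ _
  have P1 := hP _ (m1 p1 p2) _ (m1 p1 p2) _ (m1 p1 p2)
  have P2 := hP _ (m1 p1 p2) _ (m1 p1 p2) _ (m2 p1 p2)
  have P3 := hP _ (m1 p1 p2) _ (m2 p1 p2) _ (m2 p1 p2)
  have P4 := hP _ (m2 p1 p2) _ (m2 p1 p2) _ (m2 p1 p2)
  have Q : ∀ r ∈ ({q1, q2} : Set V4), ∀ s ∈ ({q1, q2} : Set V4), ∀ t ∈ ({q1, q2} : Set V4),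
      T r s t = 0 :=
    fun r hr s hs t ht => hQ _ (subset_span hr) _ (subset_span hs) _ (subset_span ht)
  have Q1 : T q1 q1 q1 = 0 := Q _ (by simp) _ (by simp) _ (by simp)
  have Q2 : T q1 q1 q2 = 0 := Q _ (by simp) _ (by simp) _ (by simp)
  have Q3 : T q1 q2 q2 = 0 := Q _ (by simp) _ (by simp) _ (by simp)
  have Q4 : T q2 q2 q2 = 0 := Q _ (by simp) _ (by simp) _ (by simp)
  have Q5 : T q2 q1 q1 = 0 := Q _ (by simp) _ (by simp) _ (by simp)
  have Q6 : T q2 q1 q2 = 0 := Q _ (by simp) _ (by simp) _ (by simp)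
  set r1 := p1 + (a • q1 + c • q2) with hr1
  set r2 := p2 + (b • q1 + d • q2) with hr2
  have R1 := hR _ (m1 r1 r2) _ (m1 r1 r2) _ (m1 r1 r2)
  have R2 := hR _ (m1 r1 r2) _ (m1 r1 r2) _ (m2 r1 r2)
  have R3 := hR _ (m1 r1 r2) _ (m2 r1 r2) _ (m2 r1 r2)
  have R4 := hR _ (m2 r1 r2) _ (m2 r1 r2) _ (m2 r1 r2)
  simp only [hr1, hr2, map_add, map_smul, LinearMap.add_apply, LinearMap.smul_apply, smul_eq_mul,
    P1, P2, P3, P4, c2 p1, c2 p2, c3 p1, c3 p2, c4, c5, c6, c7, d7,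
    Q1, Q2, Q3, Q4, Q5, Q6] at R1 R2 R3 R4
  rw [d1, d2, d3, d4, d5, d6]
  refine ⟨?_, ?_, ?_, ?_⟩
  · linear_combination R1 / 3
  · linear_combination R2
  · linear_combination R3
  · linear_combination R4 / 3

end IsSmoothCubicForm

/-- Every line among the first five of `L` meets the line spanned by `m1` and `m2`. -/
def IsTransversal (L : Fin 6 → PLine) (m1 m2 : V4) : Prop :=
  IsLine (span ℝ {m1, m2}) ∧ ∀ i, i ≠ 5 → ∃ z ∈ L i, z ≠ 0 ∧ z ∈ span ℝ {m1, m2}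

lemma exists_transversal_of_normal_form {L : Fin 6 → PLine} {p1 p2 q1 q2 : V4}
    {a b c d a' b' c' d' x y : ℝ} (hd : det2 p1 p2 q1 q2 ≠ 0)
    (h0 : L 0 = span ℝ {p1, p2}) (h1 : L 1 = span ℝ {q1, q2})
    (h2 : L 2 = span ℝ {p1 + q1, p2 + q2})
    (h3 : L 3 = span ℝ {p1 + (a • q1 + c • q2), p2 + (b • q1 + d • q2)})
    (h4 : L 4 = span ℝ {p1 + (a' • q1 + c' • q2), p2 + (b' • q1 + d' • q2)})
    (hxy : ¬ (x = 0 ∧ y = 0)) (r : x * (c * x + d * y) = y * (a * x + b * y))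
    (r' : x * (c' * x + d' * y) = y * (a' * x + b' * y)) :
    ∃ m1 m2, IsTransversal L m1 m2 := by
  have ne : ∀ s t : ℝ, ¬ (s = 0 ∧ t = 0) → s • (x • p1 + y • p2) + t • (x • q1 + y • q2) ≠ 0 := by
    intro s t hst h
    have := four_coords_eq_zero hd (x := s * x) (y := s * y) (z := t * x) (w := t * y) (by
      rw [← h]; module)
    simp only [mul_eq_zero] at this
    tauto
  have mem : ∀ s t : ℝ, s • (x • p1 + y • p2) + t • (x • q1 + y • q2) ∈
      span ℝ {x • p1 + y • p2, x • q1 + y • q2} := fun s t => mem_span_pair.mpr ⟨s, t, rfl⟩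
  have graph : ∀ a b c d : ℝ, x * (c * x + d * y) = y * (a * x + b * y) →
      ∃ z ∈ span ℝ {p1 + (a • q1 + c • q2), p2 + (b • q1 + d • q2)}, z ≠ 0 ∧
        z ∈ span ℝ {x • p1 + y • p2, x • q1 + y • q2} := by
    intro a b c d r
    obtain ⟨l, l1, l2⟩ : ∃ l : ℝ, a * x + b * y = l * x ∧ c * x + d * y = l * y := by
      by_cases hx : x = 0
      · have hy : y ≠ 0 := fun hy => hxy ⟨hx, hy⟩
        subst hx
        have hb : b = 0 := by
          have : y ^ 2 * b = 0 := by linarith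
          simpa [hy] using this
        exact ⟨d, by simp [hb], by ring⟩
      · exact ⟨(a * x + b * y) / x, by field_simp, by field_simp; linarith⟩
    refine ⟨_, mem_span_pair.mpr ⟨x, y, ?_⟩, ne 1 l (by simp), mem 1 l⟩
    linear_combination (norm := module) l1 • q1 + l2 • q2
  refine ⟨x • p1 + y • p2, x • q1 + y • q2, ?_, ?_⟩
  · rw [isLine_span_pair_iff]
    intro s t h
    by_contra hst
    exact ne s t hst h
  · intro i hi
    fin_cases i
    · exact ⟨_, h0 ▸ mem_span_pair.mpr ⟨x, y, by module⟩, ne 1 0 (by simp), mem 1 0⟩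
    · exact ⟨_, h1 ▸ mem_span_pair.mpr ⟨x, y, by module⟩, ne 0 1 (by simp), mem 0 1⟩
    · exact ⟨_, h2 ▸ mem_span_pair.mpr ⟨x, y, by module⟩, ne 1 1 (by simp), mem 1 1⟩
    · exact h3 ▸ graph _ _ _ _ r
    · exact h4 ▸ graph _ _ _ _ r'
    · exact absurd rfl hi

lemma abs_tripleSum_of_pos {D : Fin 6 → Fin 6 → ℝ} {s : ℝ} (hs : s ≠ 0)
    (h : ∀ i j, i ≠ 5 → j ≠ 5 → i ≠ j → 0 < s * D i j) : |tripleSum D 5| = 60 := by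
  have key : tripleSum D 5 = ∑ i : Fin 6, ∑ j : Fin 6, ∑ k : Fin 6,
      if (i ≠ 5 ∧ j ≠ 5 ∧ k ≠ 5) ∧ i ≠ j ∧ i ≠ k ∧ j ≠ k then Real.sign s else 0 := by
    refine Finset.sum_congr rfl fun i _ => Finset.sum_congr rfl fun j _ =>
      Finset.sum_congr rfl fun k _ => if_ctx_congr Iff.rfl (fun hc => ?_) fun _ => rfl
    have h1 := h i j hc.1.1 hc.1.2.1 hc.2.1
    have h2 := h i k hc.1.1 hc.1.2.2 hc.2.2.1
    have h3 := h j k hc.1.2.1 hc.1.2.2 hc.2.2.2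
    have hp := mul_pos (mul_pos h1 h2) h3
    rw [← Real.sign_sq_mul (inv_ne_zero hs) s, ← Real.sign_sq_mul hs]
    have e : (s⁻¹) ^ 2 * s = s⁻¹ := by field_simp
    rcases hs.lt_or_gt with hneg | hpos
    · rw [e, Real.sign_of_neg (inv_lt_zero.mpr hneg), Real.sign_of_neg]
      by_contra hcon
      nlinarith [mul_nonneg (not_lt.mp hcon) (neg_nonneg.mpr hneg.le)]
    · rw [e, Real.sign_of_pos (inv_pos.mpr hpos), Real.sign_of_pos]
      by_contra hcon
      nlinarith [mul_nonneg (neg_nonneg.mpr (not_lt.mp hcon)) hpos.le]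
  have cnt : (Finset.univ.filter fun p : Fin 6 × Fin 6 × Fin 6 =>
      (p.1 ≠ 5 ∧ p.2.1 ≠ 5 ∧ p.2.2 ≠ 5) ∧ p.1 ≠ p.2.1 ∧ p.1 ≠ p.2.2 ∧ p.2.1 ≠ p.2.2).card = 60 := by
    decide +kernel
  have : tripleSum D 5 = 60 * Real.sign s := by
    rw [key]
    have := Finset.sum_const (s := Finset.univ.filter fun p : Fin 6 × Fin 6 × Fin 6 =>
      (p.1 ≠ 5 ∧ p.2.1 ≠ 5 ∧ p.2.2 ≠ 5) ∧ p.1 ≠ p.2.1 ∧ p.1 ≠ p.2.2 ∧ p.2.1 ≠ p.2.2) (Real.sign s)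
    rw [Finset.sum_filter, cnt, Fintype.sum_prod_type] at this
    simp only [Fintype.sum_prod_type] at this
    rw [this, nsmul_eq_mul]
    norm_num
  rw [this]
  rcases hs.lt_or_gt with hneg | hpos
  · rw [Real.sign_of_neg hneg]; norm_num
  · rw [Real.sign_of_pos hpos]; norm_num

lemma IsSchlafliSix.exists_transversal {L : Fin 6 → PLine} (hL : IsSchlafliSix L)
    (hsig : |sgnOf (L ∘ (5 : Fin 6).succAbove)| ≠ 10) : ∃ m1 m2, IsTransversal L m1 m2 := by
  obtain ⟨T, hT, hv⟩ := hL.exists_form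
  have hs := hL.1
  obtain ⟨p1, p2, q1, q2, a, b, c, d, a', b', c', d', hd, h0, h1, h2, h3, h4⟩ :=
    hs.exists_normal_form
  have v0 : VanishesOn T (span ℝ {p1, p2}) := h0 ▸ hv 0
  have v1 : VanishesOn T (span ℝ {q1, q2}) := h1 ▸ hv 1
  have v3 := hv 3
  have v4 := hv 4
  rw [h3] at v3
  rw [h4] at v4
  have h2' : L 2 = span ℝ {p1 + ((1 : ℝ) • q1 + (0 : ℝ) • q2), p2 + ((0 : ℝ) • q1 + (1 : ℝ) • q2)} := by
    rw [h2]; simp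
  have h0' : L 0 = span ℝ {p1 + ((0 : ℝ) • q1 + (0 : ℝ) • q2), p2 + ((0 : ℝ) • q1 + (0 : ℝ) • q2)} := by
    rw [h0]; simp
  have v2 := hv 2
  rw [h2'] at v2
  obtain ⟨e0, e1, e2, e3⟩ := hT.graph_equations v0 v1 v2
  norm_num at e0 e1 e2 e3
  obtain ⟨E0, E1, E2, E3⟩ := hT.graph_equations v0 v1 v3
  obtain ⟨F0, F1, F2, F3⟩ := hT.graph_equations v0 v1 v4
  have s03 := hs 0 3 (by decide)
  have s04 := hs 0 4 (by decide)
  have s23 := hs 2 3 (by decide)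
  have s24 := hs 2 4 (by decide)
  have s34 := hs 3 4 (by decide)
  rw [h0', h3, skew_span_iff, det2_graph, mul_ne_zero_iff] at s03
  rw [h0', h4, skew_span_iff, det2_graph, mul_ne_zero_iff] at s04
  rw [h2', h3, skew_span_iff, det2_graph, mul_ne_zero_iff] at s23
  rw [h2', h4, skew_span_iff, det2_graph, mul_ne_zero_iff] at s24
  rw [h3, h4, skew_span_iff, det2_graph, mul_ne_zero_iff] at s34
  have nd := hT.noDoubleRoot hd v0 v1 (by linarith) (by linarith) (by linarith) (by linarith)
  obtain ⟨m, n, f0, f1, f2, f3⟩ := exists_quadratic_factor (a := a) (b := b) (c := c) (d := d)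
    (by convert s03.1 using 1; ring) (by convert s23.1 using 1; ring)
    (by linarith) (by linarith) (by linarith) (by linarith) E0 E1 E2 E3
  obtain ⟨m', n', f0', f1', f2', f3'⟩ := exists_quadratic_factor (a := a') (b := b') (c := c')
    (d := d') (by convert s04.1 using 1; ring) (by convert s24.1 using 1; ring)
    (by linarith) (by linarith) (by linarith) (by linarith) F0 F1 F2 F3
  rcases common_root_or_det_pos nd f0 f1 f2 f3 f0' f1' f2' f3' s34.1 with
    ⟨x, y, hxy, r, r'⟩ | ⟨g1, g2, g3, g4, g5⟩
  · exact exists_transversal_of_normal_form hd h0 h1 h2 h3 h4 hxy r r'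
  exfalso
  obtain ⟨v5, w5, h5⟩ := (hs 5 0 (by decide)).1.exists_span
  let v : Fin 6 → V4 := ![p1, q1, p1 + q1, p1 + (a • q1 + c • q2), p1 + (a' • q1 + c' • q2), v5]
  let w : Fin 6 → V4 := ![p2, q2, p2 + q2, p2 + (b • q1 + d • q2), p2 + (b' • q1 + d' • q2), w5]
  have hLv : L = fun i => span ℝ {v i, w i} := by
    ext1 i
    fin_cases i
    exacts [h0, h1, h2, h3, h4, h5]
  have hdv : ∀ i j, i ≠ j → det2 (v i) (w i) (v j) (w j) ≠ 0 := by
    intro i j hij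
    rw [← skew_span_iff]
    have := hs i j hij
    rwa [hLv] at this
  have h6 := tripleSum_eq_sgnOf hdv 5
  rw [← hLv] at h6
  have pos : ∀ {D e : ℝ}, D = e * det2 p1 p2 q1 q2 → 0 < e → 0 < det2 p1 p2 q1 q2 * D := by
    rintro D e rfl he
    have : 0 < e * det2 p1 p2 q1 q2 ^ 2 := by positivity
    linarith
  have hlt : ∀ i j, i < j → j ≠ 5 → 0 < det2 p1 p2 q1 q2 * det2 (v i) (w i) (v j) (w j) := by
    have l01 : 0 < det2 p1 p2 q1 q2 * det2 p1 p2 q1 q2 := pos (one_mul _).symm one_pos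
    have l1 : ∀ a b c d : ℝ, det2 q1 q2 (p1 + (a • q1 + c • q2)) (p2 + (b • q1 + d • q2)) =
        1 * det2 p1 p2 q1 q2 := by
      intros
      simp only [det2_explicit, Pi.add_apply, Pi.smul_apply, smul_eq_mul]; ring
    have l0 : ∀ a b c d : ℝ, det2 p1 p2 (p1 + (a • q1 + c • q2)) (p2 + (b • q1 + d • q2)) =
        (a * d - b * c) * det2 p1 p2 q1 q2 := by
      intros
      simp only [det2_explicit, Pi.add_apply, Pi.smul_apply, smul_eq_mul]; ring
    have l2 : ∀ a b c d : ℝ, det2 (p1 + q1) (p2 + q2) (p1 + (a • q1 + c • q2))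
        (p2 + (b • q1 + d • q2)) = ((1 - a) * (1 - d) - b * c) * det2 p1 p2 q1 q2 := by
      intros
      simp only [det2_explicit, Pi.add_apply, Pi.smul_apply, smul_eq_mul]; ring
    have k0 := l0 1 0 0 1
    have k1 := l1 1 0 0 1
    simp only [one_smul, zero_smul, add_zero, zero_add] at k0 k1
    have l34 := det2_graph p1 p2 q1 q2 a b c d a' b' c' d'
    intro i j hij hj
    fin_cases i <;> fin_cases j <;> first | exact absurd hij (by decide) | exact absurd rfl hj | skip
    exacts [l01, pos k0 (by norm_num), pos (l0 _ _ _ _) g1, pos (l0 _ _ _ _) g3,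
      pos k1 one_pos, pos (l1 _ _ _ _) one_pos, pos (l1 _ _ _ _) one_pos,
      pos (l2 _ _ _ _) g2, pos (l2 _ _ _ _) g4, pos l34 g5]
  have h60 := abs_tripleSum_of_pos (D := fun i j => det2 (v i) (w i) (v j) (w j)) hd (by
    intro i j hi hj hij
    rcases hij.lt_or_gt with h | h
    · exact hlt i j h hj
    · rw [det2_pair_comm (v j) (w j) (v i) (w i)]
      exact hlt j i h hi)
  rw [h6, abs_mul] at h60
  apply hsig
  rw [abs_of_pos (by norm_num : (0 : ℝ) < 6)] at h60
  linarith

/-- The linking sign of a triple of lines, `true` standing for a negative determinant. -/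
def tripleSign (x y z : Bool) : ℤ := if xor x (xor y z) then -1 else 1

lemma sign_mul_mul {x y z : ℝ} (hx : x ≠ 0) (hy : y ≠ 0) (hz : z ≠ 0) :
    Real.sign (x * y * z) = (tripleSign (decide (x < 0)) (decide (y < 0)) (decide (z < 0)) : ℝ) := by
  have key : ∀ x : ℝ, x ≠ 0 → ∀ y : ℝ, Real.sign (x * y) =
      (if x < 0 then -1 else 1) * Real.sign y := by
    intro x hx y
    rcases hx.lt_or_gt with h | h <;> rcases lt_trichotomy y 0 with h' | rfl | h'
    · rw [Real.sign_of_pos (mul_pos_of_neg_of_neg h h'), Real.sign_of_neg h', if_pos h]; norm_num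
    · simp
    · rw [Real.sign_of_neg (mul_neg_of_neg_of_pos h h'), Real.sign_of_pos h', if_pos h]; norm_num
    · rw [Real.sign_of_neg (mul_neg_of_pos_of_neg h h'), Real.sign_of_neg h', if_neg h.not_gt]
      norm_num
    · simp
    · rw [Real.sign_of_pos (mul_pos h h'), Real.sign_of_pos h', if_neg h.not_gt]; norm_num
  rw [mul_assoc, key x hx, key y hy, ← mul_one z, key z hz, Real.sign_one]
  by_cases h1 : x < 0 <;> by_cases h2 : y < 0 <;> by_cases h3 : z < 0 <;>
    simp [h1, h2, h3, tripleSign]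

/-- Negativity of the entries of `D`. -/
noncomputable def negEntry (D : Fin 6 → Fin 6 → ℝ) (i j : Fin 6) : Bool := decide (D i j < 0)

/-- The signature of the lines other than `r`, computed from the signs of the determinants. -/
def boolSignature (b : Fin 6 → Fin 6 → Bool) (r : Fin 6) : ℤ :=
  ∑ i, ∑ j, ∑ k, if i < j ∧ j < k then
    if i ≠ r ∧ j ≠ r ∧ k ≠ r then tripleSign (b i j) (b i k) (b j k) else 0 else 0

lemma tripleSum_eq_boolSignature {D : Fin 6 → Fin 6 → ℝ} (hD : ∀ i j, D j i = D i j)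
    (h0 : ∀ i j, i ≠ j → D i j ≠ 0) (r : Fin 6) :
    tripleSum D r = 6 * (boolSignature (negEntry D) r : ℝ) := by
  have h := sum_distinct_triples (fun i j k => if i ≠ r ∧ j ≠ r ∧ k ≠ r then
      Real.sign (D i j * D i k * D j k) else 0)
    (fun i j k => if_congr (by tauto) (by rw [hD i j]; congr 1; ring) rfl)
    (fun i j k => if_congr (by tauto) (by rw [hD j k]; congr 1; ring) rfl)
  have e : tripleSum D r = ∑ i, ∑ j, ∑ k, if i ≠ j ∧ i ≠ k ∧ j ≠ k then
      if i ≠ r ∧ j ≠ r ∧ k ≠ r then Real.sign (D i j * D i k * D j k) else 0 else 0 := by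
    refine Finset.sum_congr rfl fun i _ => Finset.sum_congr rfl fun j _ =>
      Finset.sum_congr rfl fun k _ => ?_
    rw [← ite_and]
    exact if_congr (by tauto) rfl rfl
  rw [e, h, boolSignature]
  congr 1
  push_cast
  refine Finset.sum_congr rfl fun i _ => Finset.sum_congr rfl fun j _ =>
    Finset.sum_congr rfl fun k _ => if_ctx_congr Iff.rfl (fun hc => ?_) fun _ => rfl
  split_ifs
  · rw [sign_mul_mul (h0 _ _ hc.1.ne) (h0 _ _ (hc.1.trans hc.2).ne) (h0 _ _ hc.2.ne)]
    rfl
  · rfl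

/-- All five-line subconfigurations have signature of absolute value two or four. -/
def SmallSignatures (b : Fin 6 → Fin 6 → Bool) : Prop :=
  ∀ r, |boolSignature b r| = 2 ∨ |boolSignature b r| = 4

/-- The lines `j` and `k` have the same linking with each of the first five lines. -/
def Twins (b : Fin 6 → Fin 6 → Bool) (j k : Fin 6) : Prop :=
  ∀ l, l ≠ 5 → l ≠ j → l ≠ k → b j l = b k l

lemma exists_twins_of_plucker {b : Fin 6 → Fin 6 → Bool} (hb : ∀ i j, b j i = b i j)
    (h5 : ∀ i, i ≠ 5 → b i 5 = true) (hs : SmallSignatures b)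
    (hp : ∀ i j k l : Fin 6, i < j → j < k → k < l → l ≠ 5 →
      ¬ ((b i j == b k l) = !(b i k == b j l) ∧ (b i j == b k l) = (b i l == b j k))) :
    Twins b 0 1 ∨ Twins b 1 2 ∨ Twins b 2 3 ∨ Twins b 3 4 ∨ Twins b 0 4 := by
  have s0 := hs 0
  have s1 := hs 1
  have s2 := hs 2
  have s3 := hs 3
  have s4 := hs 4
  have s5 := hs 5
  have p0 := hp 1 2 3 4 (by decide) (by decide) (by decide) (by decide)
  have p1 := hp 0 2 3 4 (by decide) (by decide) (by decide) (by decide)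
  have p2 := hp 0 1 3 4 (by decide) (by decide) (by decide) (by decide)
  have p3 := hp 0 1 2 4 (by decide) (by decide) (by decide) (by decide)
  have p4 := hp 0 1 2 3 (by decide) (by decide) (by decide) (by decide)
  simp [boolSignature, Fin.sum_univ_succ, h5] at s0 s1 s2 s3 s4 s5
  have t : ∀ i j, Twins b i j ↔ ((0 ≠ i → 0 ≠ j → b i 0 = b j 0) ∧ (1 ≠ i → 1 ≠ j → b i 1 = b j 1) ∧
      (2 ≠ i → 2 ≠ j → b i 2 = b j 2) ∧ (3 ≠ i → 3 ≠ j → b i 3 = b j 3) ∧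
      (4 ≠ i → 4 ≠ j → b i 4 = b j 4)) := by
    intro i j
    simp [Twins, Fin.forall_fin_succ]
  simp only [t]
  simp [hb 0 1, hb 0 2, hb 0 3, hb 0 4, hb 1 2, hb 1 3, hb 1 4, hb 2 3, hb 2 4, hb 3 4]
  have H := And.intro s0 <| And.intro s1 <| And.intro s2 <| And.intro s3 <| And.intro s4 <|
    And.intro s5 <| And.intro p0 <| And.intro p1 <| And.intro p2 <| And.intro p3 p4
  clear h5 hs hp t hb s0 s1 s2 s3 s4 s5 p0 p1 p2 p3 p4
  generalize b 0 1 = x01, b 0 2 = x02, b 0 3 = x03, b 0 4 = x04, b 1 2 = x12, b 1 3 = x13,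
    b 1 4 = x14, b 2 3 = x23, b 2 4 = x24, b 3 4 = x34 at H ⊢
  clear b
  revert x01 x02 x03 x04 x12 x13 x14 x23 x24 x34
  set_option synthInstance.maxHeartbeats 400000 in
  set_option synthInstance.maxSize 4000 in
  decide +kernel

/-- The line `j` has the same linking with all of the first five lines. -/
def ConstantRow (b : Fin 6 → Fin 6 → Bool) (j : Fin 6) : Prop :=
  ∃ c, ∀ l, l ≠ 5 → l ≠ j → b j l = c

lemma exists_twins_of_transitive {b : Fin 6 → Fin 6 → Bool} (hb : ∀ i j, b j i = b i j)
    (h5 : ∀ i, i ≠ 5 → b i 5 = true) (hs : SmallSignatures b)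
    (hp : ∀ i j k : Fin 6, i < j → j < k → k ≠ 5 → b i j = b j k → b i k = b i j) :
    Twins b 0 1 ∨ Twins b 1 2 ∨ Twins b 2 3 ∨ Twins b 3 4 ∨ ConstantRow b 0 ∨ ConstantRow b 4 := by
  have s0 := hs 0
  have s1 := hs 1
  have s2 := hs 2
  have s3 := hs 3
  have s4 := hs 4
  have s5 := hs 5
  have p012 := hp 0 1 2 (by decide) (by decide) (by decide)
  have p013 := hp 0 1 3 (by decide) (by decide) (by decide)
  have p014 := hp 0 1 4 (by decide) (by decide) (by decide)
  have p023 := hp 0 2 3 (by decide) (by decide) (by decide)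
  have p024 := hp 0 2 4 (by decide) (by decide) (by decide)
  have p034 := hp 0 3 4 (by decide) (by decide) (by decide)
  have p123 := hp 1 2 3 (by decide) (by decide) (by decide)
  have p124 := hp 1 2 4 (by decide) (by decide) (by decide)
  have p134 := hp 1 3 4 (by decide) (by decide) (by decide)
  have p234 := hp 2 3 4 (by decide) (by decide) (by decide)
  simp [boolSignature, Fin.sum_univ_succ, h5] at s0 s1 s2 s3 s4 s5
  have t : ∀ i j, Twins b i j ↔ ((0 ≠ i → 0 ≠ j → b i 0 = b j 0) ∧ (1 ≠ i → 1 ≠ j → b i 1 = b j 1) ∧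
      (2 ≠ i → 2 ≠ j → b i 2 = b j 2) ∧ (3 ≠ i → 3 ≠ j → b i 3 = b j 3) ∧
      (4 ≠ i → 4 ≠ j → b i 4 = b j 4)) := by
    intro i j
    simp [Twins, Fin.forall_fin_succ]
  have tc : ∀ i, ConstantRow b i ↔ ∃ c, (0 ≠ i → b i 0 = c) ∧ (1 ≠ i → b i 1 = c) ∧
      (2 ≠ i → b i 2 = c) ∧ (3 ≠ i → b i 3 = c) ∧ (4 ≠ i → b i 4 = c) := by
    intro i
    simp [ConstantRow, Fin.forall_fin_succ]
  simp only [t, tc]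
  simp [hb 0 1, hb 0 2, hb 0 3, hb 0 4, hb 1 2, hb 1 3, hb 1 4, hb 2 3, hb 2 4, hb 3 4]
  have H := And.intro s0 <| And.intro s1 <| And.intro s2 <| And.intro s3 <| And.intro s4 <|
    And.intro s5 <| And.intro p012 <| And.intro p013 <| And.intro p014 <| And.intro p023 <|
    And.intro p024 <| And.intro p034 <| And.intro p123 <| And.intro p124 <| And.intro p134 p234
  clear h5 hs hp t tc hb s0 s1 s2 s3 s4 s5 p012 p013 p014 p023 p024 p034 p123 p124 p134 p234
  generalize b 0 1 = x01, b 0 2 = x02, b 0 3 = x03, b 0 4 = x04, b 1 2 = x12, b 1 3 = x13,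
    b 1 4 = x14, b 2 3 = x23, b 2 4 = x24, b 3 4 = x34 at H ⊢
  clear b
  revert x01 x02 x03 x04 x12 x13 x14 x23 x24 x34
  set_option synthInstance.maxHeartbeats 400000 in
  set_option synthInstance.maxSize 4000 in
  decide +kernel

/-- Lines in a chart where the line `x₂ = x₃ = 0` meets the first five lines, but not the line
`x₀ = x₁ = 0`, which is the sixth one. -/
structure DisjointChart (v w : Fin 6 → V4) (s p q : Fin 6 → ℝ) : Prop where
  v_eq : ∀ j, j ≠ 5 → v j = ![1, s j, 0, 0]
  w_eq : ∀ j, j ≠ 5 → w j = ![-s j, 1, p j, q j]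
  v_five : v 5 = ![0, 0, 0, 1]
  w_five : w 5 = ![0, 0, 1, 0]

/-- Lines in a chart where the line `x₂ = x₃ = 0` meets all of them, the sixth one being
`x₀ = x₂ = 0`. -/
structure SecantChart (v w : Fin 6 → V4) (s f q : Fin 6 → ℝ) : Prop where
  v_eq : ∀ j, j ≠ 5 → v j = ![1, s j, 0, 0]
  w_eq : ∀ j, j ≠ 5 → w j = ![0, f j, 1, q j]
  v_five : v 5 = ![0, 1, 0, 0]
  w_five : w 5 = ![0, 0, 0, 1]

lemma segment_ne_zero {x y t : ℝ} (h : 0 < x * y) (ht : t ∈ Set.Icc (0 : ℝ) 1) :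
    (1 - t) * x + t * y ≠ 0 := by
  intro e
  have hx : x ≠ 0 := by rintro rfl; simp at h
  have h1 : 0 ≤ (1 - t) * x ^ 2 := mul_nonneg (by linarith [ht.2]) (sq_nonneg x)
  have h2 : 0 ≤ t * (x * y) := mul_nonneg ht.1 h.le
  have h3 : (1 - t) * x ^ 2 + t * (x * y) = 0 := by linear_combination x * e
  have h4 : 1 - t = 0 := by
    have : (1 - t) * x ^ 2 = 0 := by linarith
    simpa [hx] using this
  have h5 : t = 1 := by linarith
  subst h5
  linarith

lemma mul_pos_of_decide_eq {x y : ℝ} (hx : x ≠ 0) (hy : y ≠ 0)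
    (h : decide (x < 0) = decide (y < 0)) : 0 < x * y := by
  rw [decide_eq_decide] at h
  rcases hx.lt_or_gt with h1 | h1
  · exact mul_pos_of_neg_of_neg h1 (h.mp h1)
  · exact mul_pos h1 (hy.lt_or_gt.resolve_left fun h2 => absurd (h.mpr h2) h1.not_gt)

lemma decide_neg_beq {x y : ℝ} (hx : x ≠ 0) (hy : y ≠ 0) :
    (decide (x < 0) == decide (y < 0)) = decide (0 < x * y) := by
  rcases hx.lt_or_gt with h1 | h1 <;> rcases hy.lt_or_gt with h2 | h2
  · simp [h1, h2, mul_pos_of_neg_of_neg h1 h2]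
  · simp [h1, h2.not_gt, (mul_neg_of_neg_of_pos h1 h2).not_gt]
  · simp [h2, h1.not_gt, (mul_neg_of_pos_of_neg h1 h2).not_gt]
  · simp [h2.not_gt, h1.not_gt, mul_pos h1 h2]

lemma smallSignatures_of_tripleSum {D : Fin 6 → Fin 6 → ℝ} (hD : ∀ i j, D j i = D i j)
    (h0 : ∀ i j, i ≠ j → D i j ≠ 0) (hs : ∀ r, |tripleSum D r| = 12 ∨ |tripleSum D r| = 24) :
    SmallSignatures (negEntry D) := by
  intro r
  have h : (6 : ℝ) * |(boolSignature (negEntry D) r : ℝ)| = 12 ∨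
      (6 : ℝ) * |(boolSignature (negEntry D) r : ℝ)| = 24 := by
    simpa [tripleSum_eq_boolSignature hD h0, abs_mul] using hs r
  rw [← Int.cast_abs] at h
  exact h.imp (fun h => by exact_mod_cast (by linarith : ((|boolSignature _ r| : ℤ) : ℝ) = 2))
    (fun h => by exact_mod_cast (by linarith : ((|boolSignature _ r| : ℤ) : ℝ) = 4))

section DisjointChart

variable {v w : Fin 6 → V4} {s p q : Fin 6 → ℝ}

lemma DisjointChart.det2_eq (h : DisjointChart v w s p q) {i j : Fin 6} (hi : i ≠ 5)
    (hj : j ≠ 5) : det2 (v i) (w i) (v j) (w j) = -((s j - s i) * (p i * q j - p j * q i)) := by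
  rw [h.v_eq i hi, h.v_eq j hj, h.w_eq i hi, h.w_eq j hj, det2_explicit]
  simp
  ring

lemma DisjointChart.det2_five (h : DisjointChart v w s p q) {i : Fin 6} (hi : i ≠ 5) :
    det2 (v i) (w i) (v 5) (w 5) = -(1 + s i ^ 2) := by
  rw [h.v_eq i hi, h.w_eq i hi, h.v_five, h.w_five, det2_explicit]
  simp
  ring

lemma DisjointChart.reducible_of_twins (h : DisjointChart v w s p q)
    (hd : ∀ i j, i ≠ j → det2 (v i) (w i) (v j) (w j) ≠ 0) {j k : Fin 6} (hjk : j ≠ k)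
    (hj : j ≠ 5) (hk : k ≠ 5) (e : ℝ) (he : e = 1 ∨ e = -1)
    (hs : ∀ l, l ≠ 5 → l ≠ j → l ≠ k → 0 < e * ((s j - s l) * (s k - s l)))
    (ht : Twins (negEntry fun i j => det2 (v i) (w i) (v j) (w j)) j k) :
    Reducible (fun i => span ℝ {v i, w i}) := by
  have he0 : e ≠ 0 := by rcases he with rfl | rfl <;> norm_num
  refine reducible_of_merge hjk (e • v j) (e • w j)
    (span_pair_eq (x := e) (y := 0) (z := 0) (t := e) (by simpa using he0) (by simp) (by simp))
    hd (fun l hlj hlk t htt => ?_) (fun t htt => ?_)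
  · by_cases hl : l = 5
    · subst hl
      have hsum : det2 (v 5) (w 5) ((1 - t) • v k + t • e • v j) ((1 - t) • w k + t • e • w j) =
          -(((1 - t) + t * e) ^ 2 + ((1 - t) * s k + t * (e * s j)) ^ 2) := by
        rw [h.v_eq j hj, h.v_eq k hk, h.w_eq j hj, h.w_eq k hk, h.v_five, h.w_five, det2_explicit]
        simp
        ring
      rw [hsum, neg_ne_zero]
      intro h0
      have h1 : (1 - t) + t * e = 0 := by nlinarith
      have h2 : (1 - t) * s k + t * (e * s j) = 0 := by nlinarith
      have h3 : (1 - t) * (s j - s k) = 0 := by linear_combination s j * h1 - h2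
      have hne : s j - s k ≠ 0 := by
        intro h4
        apply hd k j hjk.symm
        rw [h.det2_eq hk hj, h4, zero_mul, neg_zero]
      have h5 : 1 - t = 0 := by simpa [hne] using h3
      have h6 : t = 1 := by linarith
      subst h6
      apply he0
      linarith
    · have hprod : det2 (v l) (w l) ((1 - t) • v k + t • e • v j) ((1 - t) • w k + t • e • w j) =
          -(((1 - t) * (s k - s l) + t * (e * (s j - s l))) *
            ((1 - t) * (p l * q k - p k * q l) + t * (e * (p l * q j - p j * q l)))) := by
        rw [h.v_eq j hj, h.v_eq k hk, h.w_eq j hj, h.w_eq k hk, h.v_eq l hl, h.w_eq l hl,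
          det2_explicit]
        simp
        ring
      have h1 := hs l hl hlj hlk
      have h2 : 0 < ((s l - s j) * (p j * q l - p l * q j)) *
          ((s l - s k) * (p k * q l - p l * q k)) := by
        have := mul_pos_of_decide_eq (hd j l hlj.symm) (hd k l hlk.symm) (ht l hl hlj hlk)
        rw [h.det2_eq hj hl, h.det2_eq hk hl] at this
        linarith
      have h3 : 0 < e * ((p j * q l - p l * q j) * (p k * q l - p l * q k)) := by
        have he2 : e * e = 1 := by rcases he with rfl | rfl <;> norm_num
        refine pos_of_mul_pos_right (a := e * ((s j - s l) * (s k - s l))) ?_ h1.le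
        have e4 : e * ((s j - s l) * (s k - s l)) *
            (e * ((p j * q l - p l * q j) * (p k * q l - p l * q k))) =
            (e * e) * (((s l - s j) * (p j * q l - p l * q j)) *
              ((s l - s k) * (p k * q l - p l * q k))) := by ring
        rw [e4, he2, one_mul]
        exact h2
      rw [hprod, neg_ne_zero]
      exact mul_ne_zero (segment_ne_zero (by linarith) htt) (segment_ne_zero (by linarith) htt)
  · have hprod : det2 (v j) (w j) ((1 - t) • v k + t • e • v j) ((1 - t) • w k + t • e • w j) =
        (1 - t) ^ 2 * det2 (v j) (w j) (v k) (w k) := by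
      simp only [det2_explicit, Pi.add_apply, Pi.smul_apply, smul_eq_mul]
      ring
    rw [hprod]
    have : 1 - t ≠ 0 := by linarith [htt.2]
    exact mul_ne_zero (pow_ne_zero _ this) (hd j k hjk)

lemma DisjointChart.reducible_of_sorted (h : DisjointChart v w s p q)
    (hd : ∀ i j, i ≠ j → det2 (v i) (w i) (v j) (w j) ≠ 0)
    (hsig : ∀ r, |tripleSum (fun i j => det2 (v i) (w i) (v j) (w j)) r| = 12 ∨
      |tripleSum (fun i j => det2 (v i) (w i) (v j) (w j)) r| = 24)
    (hs : ∀ i j, i < j → j ≠ 5 → s i < s j) :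
    Reducible (fun i => span ℝ {v i, w i}) := by
  have hlt : ∀ i j : Fin 6, i < j → j ≠ 5 → i ≠ 5 := by decide
  have hpos : ∀ i j k l : Fin 6, i < j → k < l → j ≠ 5 → l ≠ 5 →
      (negEntry (fun i j => det2 (v i) (w i) (v j) (w j)) i j ==
        negEntry (fun i j => det2 (v i) (w i) (v j) (w j)) k l) =
        decide (0 < (p i * q j - p j * q i) * (p k * q l - p l * q k)) := by
    intro i j k l hij hkl hj hl
    rw [negEntry, negEntry, decide_neg_beq (hd _ _ hij.ne) (hd _ _ hkl.ne), decide_eq_decide,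
      h.det2_eq (hlt _ _ hij hj) hj, h.det2_eq (hlt _ _ hkl hl) hl]
    have e : -((s j - s i) * (p i * q j - p j * q i)) * -((s l - s k) * (p k * q l - p l * q k)) =
        ((s j - s i) * (s l - s k)) * ((p i * q j - p j * q i) * (p k * q l - p l * q k)) := by ring
    rw [e, mul_pos_iff_of_pos_left
      (mul_pos (sub_pos.mpr (hs _ _ hij hj)) (sub_pos.mpr (hs _ _ hkl hl)))]
  have hne : ∀ i j : Fin 6, i < j → j ≠ 5 → p i * q j - p j * q i ≠ 0 := by
    intro i j hij hj h0
    apply hd i j hij.ne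
    rw [h.det2_eq (hlt _ _ hij hj) hj, h0, mul_zero, neg_zero]
  have htw := exists_twins_of_plucker
    (b := negEntry fun i j => det2 (v i) (w i) (v j) (w j))
    (fun i j => by simp only [negEntry, det2_pair_comm (v i) (w i)])
    (fun i hi => by
      simp only [negEntry, h.det2_five hi, decide_eq_true_eq]
      nlinarith [sq_nonneg (s i)])
    (smallSignatures_of_tripleSum (fun i j => det2_pair_comm ..) hd hsig)
    (by
      rintro i j k l hij hjk hkl hl ⟨h1, h2⟩
      have hk := hlt _ _ hkl hl
      have hj := hlt _ _ hjk hk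
      rw [hpos _ _ _ _ hij hkl hj hl, hpos _ _ _ _ (hij.trans hjk) (hjk.trans hkl) hk hl] at h1
      rw [hpos _ _ _ _ hij hkl hj hl, hpos _ _ _ _ (hij.trans (hjk.trans hkl)) hjk hl hk] at h2
      have hX := mul_ne_zero (hne i j hij hj) (hne k l hkl hl)
      have hid : (p i * q j - p j * q i) * (p k * q l - p l * q k) -
          (p i * q k - p k * q i) * (p j * q l - p l * q j) +
          (p i * q l - p l * q i) * (p j * q k - p k * q j) = 0 := by ring
      rw [decide_eq_decide] at h2
      rw [← decide_not, decide_eq_decide] at h1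
      rcases hX.lt_or_gt with hX | hX
      · have h3 := mt h2.mpr hX.not_gt
        have h4 := not_not.mp (mt h1.mpr hX.not_gt)
        linarith
      · have h3 := h2.mp hX
        have h4 := h1.mp hX
        linarith)
  have hadj : ∀ j k : Fin 6, j < k → k ≠ 5 → (∀ l, l ≠ j → l ≠ k → l < j ∨ k < l) →
      Twins (negEntry fun i j => det2 (v i) (w i) (v j) (w j)) j k →
      Reducible (fun i => span ℝ {v i, w i}) := by
    intro j k hjk hk hl ht
    refine h.reducible_of_twins hd hjk.ne (hlt _ _ hjk hk) hk 1 (Or.inl rfl)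
      (fun l hl5 hlj hlk => ?_) ht
    rw [one_mul]
    rcases hl l hlj hlk with h1 | h1
    · exact mul_pos (sub_pos.mpr (hs _ _ h1 (hlt _ _ hjk hk)))
        (sub_pos.mpr (hs _ _ (h1.trans hjk) hk))
    · exact mul_pos_of_neg_of_neg (sub_neg.mpr (hs _ _ (hjk.trans h1) hl5))
        (sub_neg.mpr (hs _ _ h1 hl5))
  rcases htw with ht | ht | ht | ht | ht
  · exact hadj 0 1 (by decide) (by decide) (by decide) ht
  · exact hadj 1 2 (by decide) (by decide) (by decide) ht
  · exact hadj 2 3 (by decide) (by decide) (by decide) ht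
  · exact hadj 3 4 (by decide) (by decide) (by decide) ht
  · refine h.reducible_of_twins hd (by decide) (by decide) (by decide) (-1) (Or.inr rfl)
      (fun l hl5 hl0 hl4 => ?_) ht
    have h0 : (0 : Fin 6) < l := Fin.pos_iff_ne_zero.mpr hl0
    have h4 : l < 4 := by revert l; decide
    nlinarith [hs _ _ h0 hl5, hs _ _ h4 (by decide)]

end DisjointChart

section SecantChart

variable {v w : Fin 6 → V4} {s f q : Fin 6 → ℝ}

lemma SecantChart.det2_eq (h : SecantChart v w s f q) {i j : Fin 6} (hi : i ≠ 5)
    (hj : j ≠ 5) : det2 (v i) (w i) (v j) (w j) = -((s j - s i) * (q j - q i)) := by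
  rw [h.v_eq i hi, h.v_eq j hj, h.w_eq i hi, h.w_eq j hj, det2_explicit]
  simp
  ring

lemma SecantChart.det2_five (h : SecantChart v w s f q) {i : Fin 6} (hi : i ≠ 5) :
    det2 (v i) (w i) (v 5) (w 5) = -1 := by
  rw [h.v_eq i hi, h.w_eq i hi, h.v_five, h.w_five, det2_explicit]
  simp

lemma SecantChart.reducible_of_twins (h : SecantChart v w s f q)
    (hd : ∀ i j, i ≠ j → det2 (v i) (w i) (v j) (w j) ≠ 0) {j k : Fin 6} (hjk : j ≠ k)
    (hj : j ≠ 5) (hk : k ≠ 5)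
    (hs : ∀ l, l ≠ 5 → l ≠ j → l ≠ k → 0 < (s j - s l) * (s k - s l))
    (ht : Twins (negEntry fun i j => det2 (v i) (w i) (v j) (w j)) j k) :
    Reducible (fun i => span ℝ {v i, w i}) := by
  refine reducible_of_merge hjk (v j) (w j) rfl hd (fun l hlj hlk t htt => ?_) (fun t htt => ?_)
  · by_cases hl : l = 5
    · subst hl
      have hsum : det2 (v 5) (w 5) ((1 - t) • v k + t • v j) ((1 - t) • w k + t • w j) = -1 := by
        rw [h.v_eq j hj, h.v_eq k hk, h.w_eq j hj, h.w_eq k hk, h.v_five, h.w_five, det2_explicit]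
        simp
      rw [hsum]
      norm_num
    · have hprod : det2 (v l) (w l) ((1 - t) • v k + t • v j) ((1 - t) • w k + t • w j) =
          -(((1 - t) * (s k - s l) + t * (s j - s l)) *
            ((1 - t) * (q k - q l) + t * (q j - q l))) := by
        rw [h.v_eq j hj, h.v_eq k hk, h.w_eq j hj, h.w_eq k hk, h.v_eq l hl, h.w_eq l hl,
          det2_explicit]
        simp
        ring
      have h1 := hs l hl hlj hlk
      have h2 : 0 < ((s j - s l) * (s k - s l)) * ((q k - q l) * (q j - q l)) := by
        have := mul_pos_of_decide_eq (hd j l hlj.symm) (hd k l hlk.symm) (ht l hl hlj hlk)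
        rw [h.det2_eq hj hl, h.det2_eq hk hl] at this
        linarith
      have h3 := pos_of_mul_pos_right h2 h1.le
      rw [hprod, neg_ne_zero]
      exact mul_ne_zero (segment_ne_zero (by linarith) htt) (segment_ne_zero h3 htt)
  · have hprod : det2 (v j) (w j) ((1 - t) • v k + t • v j) ((1 - t) • w k + t • w j) =
        (1 - t) ^ 2 * det2 (v j) (w j) (v k) (w k) := by
      simp only [det2_explicit, Pi.add_apply, Pi.smul_apply, smul_eq_mul]
      ring
    rw [hprod]
    have : 1 - t ≠ 0 := by linarith [htt.2]
    exact mul_ne_zero (pow_ne_zero _ this) (hd j k hjk)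

lemma SecantChart.reducible_of_extreme (h : SecantChart v w s f q)
    (hd : ∀ i j, i ≠ j → det2 (v i) (w i) (v j) (w j) ≠ 0) {k : Fin 6} (hk : k ≠ 5) {e e' : ℝ}
    (he : e ≠ 0) (he' : e' ≠ 0) (hs : ∀ l, l ≠ 5 → l ≠ k → 0 < (s k - s l) * e)
    (hq : ∀ l, l ≠ 5 → l ≠ k → 0 < (q k - q l) * e') :
    Reducible (fun i => span ℝ {v i, w i}) := by
  refine reducible_of_merge hk.symm (e • v 5) (e' • w 5)
    (span_pair_eq (x := e) (y := 0) (z := 0) (t := e') (by simpa using ⟨he, he'⟩) (by simp)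
      (by simp)) hd (fun l hl hlk t htt => ?_) (fun t htt => ?_)
  · have hprod : det2 (v l) (w l) ((1 - t) • v k + t • e • v 5) ((1 - t) • w k + t • e' • w 5) =
        -(((1 - t) * (s k - s l) + t * e) * ((1 - t) * (q k - q l) + t * e')) := by
      rw [h.v_five, h.v_eq k hk, h.w_five, h.w_eq k hk, h.v_eq l hl, h.w_eq l hl, det2_explicit]
      simp
      ring
    rw [hprod, neg_ne_zero]
    exact mul_ne_zero (segment_ne_zero (hs l hl hlk) htt) (segment_ne_zero (hq l hl hlk) htt)
  · have hprod : det2 (v 5) (w 5) ((1 - t) • v k + t • e • v 5) ((1 - t) • w k + t • e' • w 5) =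
        (1 - t) ^ 2 * det2 (v 5) (w 5) (v k) (w k) := by
      simp only [det2_explicit, Pi.add_apply, Pi.smul_apply, smul_eq_mul]
      ring
    rw [hprod]
    have : 1 - t ≠ 0 := by linarith [htt.2]
    exact mul_ne_zero (pow_ne_zero _ this) (hd 5 k hk.symm)

lemma SecantChart.reducible_of_constantRow (h : SecantChart v w s f q)
    (hd : ∀ i j, i ≠ j → det2 (v i) (w i) (v j) (w j) ≠ 0) {k : Fin 6} (hk : k ≠ 5) {e : ℝ}
    (he : e = 1 ∨ e = -1) (hs : ∀ l, l ≠ 5 → l ≠ k → 0 < (s k - s l) * e)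
    (hc : ConstantRow (negEntry fun i j => det2 (v i) (w i) (v j) (w j)) k) :
    Reducible (fun i => span ℝ {v i, w i}) := by
  obtain ⟨c, hc⟩ := hc
  have he0 : e ≠ 0 := by rcases he with rfl | rfl <;> norm_num
  have hd' : ∀ l, l ≠ 5 → l ≠ k → det2 (v k) (w k) (v l) (w l) = -((s k - s l) * (q k - q l)) := by
    intro l hl hlk
    rw [h.det2_eq hk hl]
    ring
  have key : ∀ l, l ≠ 5 → l ≠ k →
      0 < ((s k - s l) * e) * ((q k - q l) * (if c then e else -e)) := by
    intro l hl hlk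
    have he2 : e * e = 1 := by rcases he with rfl | rfl <;> norm_num
    have h1 := hd k l hlk.symm
    have h2 := hc l hl hlk
    rw [negEntry] at h2
    rw [hd' l hl hlk] at h1 h2
    cases c
    · have h3 : 0 < -((s k - s l) * (q k - q l)) :=
        h1.lt_or_gt.resolve_left (of_decide_eq_false h2)
      simp only [Bool.false_eq_true, if_false]
      linear_combination h3 + (s k - s l) * (q k - q l) * he2
    · have h3 : -((s k - s l) * (q k - q l)) < 0 := of_decide_eq_true h2
      simp only [if_true]
      linear_combination h3 - (s k - s l) * (q k - q l) * he2
  refine h.reducible_of_extreme hd hk he0 (e' := if c then e else -e) ?_ hs fun l hl hlk =>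
    pos_of_mul_pos_right (key l hl hlk) (hs l hl hlk).le
  split_ifs
  · exact he0
  · exact neg_ne_zero.mpr he0

lemma SecantChart.reducible_of_sorted (h : SecantChart v w s f q)
    (hd : ∀ i j, i ≠ j → det2 (v i) (w i) (v j) (w j) ≠ 0)
    (hsig : ∀ r, |tripleSum (fun i j => det2 (v i) (w i) (v j) (w j)) r| = 12 ∨
      |tripleSum (fun i j => det2 (v i) (w i) (v j) (w j)) r| = 24)
    (hs : ∀ i j, i < j → j ≠ 5 → s i < s j) :
    Reducible (fun i => span ℝ {v i, w i}) := by
  have hlt : ∀ i j : Fin 6, i < j → j ≠ 5 → i ≠ 5 := by decide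
  have hb : ∀ i j : Fin 6, i < j → j ≠ 5 →
      negEntry (fun i j => det2 (v i) (w i) (v j) (w j)) i j = decide (q i < q j) := by
    intro i j hij hj
    rw [negEntry, decide_eq_decide, h.det2_eq (hlt _ _ hij hj) hj, neg_lt_zero,
      mul_pos_iff_of_pos_left (sub_pos.mpr (hs _ _ hij hj)), sub_pos]
  have hne : ∀ i j : Fin 6, i < j → j ≠ 5 → q i ≠ q j := by
    intro i j hij hj h0
    apply hd i j hij.ne
    rw [h.det2_eq (hlt _ _ hij hj) hj, h0, sub_self, mul_zero, neg_zero]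
  have htw := exists_twins_of_transitive
    (b := negEntry fun i j => det2 (v i) (w i) (v j) (w j))
    (fun i j => by simp only [negEntry, det2_pair_comm (v i) (w i)])
    (fun i hi => by simp [negEntry, h.det2_five hi])
    (smallSignatures_of_tripleSum (fun i j => det2_pair_comm ..) hd hsig)
    (by
      intro i j k hij hjk hk
      have hj := hlt _ _ hjk hk
      rw [hb _ _ hij hj, hb _ _ hjk hk, hb _ _ (hij.trans hjk) hk, decide_eq_decide,
        decide_eq_decide]
      intro h1
      rcases (hne _ _ hij hj).lt_or_gt with h2 | h2
      · exact iff_of_true (h2.trans (h1.mp h2)) h2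
      · have h3 := (hne _ _ hjk hk).lt_or_gt.resolve_left fun h3 => (h1.mpr h3).not_gt h2
        exact iff_of_false (h3.trans h2).not_gt h2.not_gt)
  have hadj : ∀ j k : Fin 6, j < k → k ≠ 5 → (∀ l, l ≠ j → l ≠ k → l < j ∨ k < l) →
      Twins (negEntry fun i j => det2 (v i) (w i) (v j) (w j)) j k →
      Reducible (fun i => span ℝ {v i, w i}) := by
    intro j k hjk hk hl ht
    refine h.reducible_of_twins hd hjk.ne (hlt _ _ hjk hk) hk (fun l hl5 hlj hlk => ?_) ht
    rcases hl l hlj hlk with h1 | h1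
    · exact mul_pos (sub_pos.mpr (hs _ _ h1 (hlt _ _ hjk hk)))
        (sub_pos.mpr (hs _ _ (h1.trans hjk) hk))
    · exact mul_pos_of_neg_of_neg (sub_neg.mpr (hs _ _ (hjk.trans h1) hl5))
        (sub_neg.mpr (hs _ _ h1 hl5))
  rcases htw with ht | ht | ht | ht | ht | ht
  · exact hadj 0 1 (by decide) (by decide) (by decide) ht
  · exact hadj 1 2 (by decide) (by decide) (by decide) ht
  · exact hadj 2 3 (by decide) (by decide) (by decide) ht
  · exact hadj 3 4 (by decide) (by decide) (by decide) ht
  · refine h.reducible_of_constantRow hd (by decide) (Or.inr rfl) (fun l hl5 hl0 => ?_) ht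
    linarith [hs 0 l (Fin.pos_iff_ne_zero.mpr hl0) hl5]
  · refine h.reducible_of_constantRow hd (by decide) (Or.inl rfl) (fun l hl5 hl4 => ?_) ht
    have h4 : l < 4 := by revert l; decide
    linarith [hs _ _ h4 (by decide)]

end SecantChart

/-- The first five indices can be sorted by the values of an injective function on them. -/
lemma exists_perm_sorted {s : Fin 6 → ℝ} (hs : ∀ i j, i ≠ 5 → j ≠ 5 → i ≠ j → s i ≠ s j) :
    ∃ σ : Equiv.Perm (Fin 6), σ 5 = 5 ∧ ∀ i j, i < j → j ≠ 5 → s (σ i) < s (σ j) := by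
  let g : Fin 6 → WithTop ℝ := fun i => if i = 5 then ⊤ else (s i : WithTop ℝ)
  have hm := Tuple.monotone_sort g
  generalize Tuple.sort g = τ at hm
  have h5 : τ 5 = 5 := by
    obtain ⟨i, hi⟩ := τ.surjective 5
    have h1 : g (τ i) ≤ g (τ 5) := hm (Fin.le_last i)
    by_contra h3
    simp [g, hi, h3] at h1
  have hn : ∀ i, i ≠ 5 → τ i ≠ 5 := fun i hi h => hi (τ.injective (h.trans h5.symm))
  refine ⟨τ, h5, fun i j hij hj => ?_⟩
  have hi : i ≠ 5 := by revert i j; decide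
  refine lt_of_le_of_ne ?_ (hs _ _ (hn i hi) (hn j hj) (τ.injective.ne hij.ne))
  have := hm hij.le
  simpa [g, hn i hi, hn j hj] using this

lemma DisjointChart.reducible {v w : Fin 6 → V4} {s p q : Fin 6 → ℝ}
    (h : DisjointChart v w s p q)
    (hd : ∀ i j, i ≠ j → det2 (v i) (w i) (v j) (w j) ≠ 0)
    (hsig : ∀ r, |tripleSum (fun i j => det2 (v i) (w i) (v j) (w j)) r| = 12 ∨
      |tripleSum (fun i j => det2 (v i) (w i) (v j) (w j)) r| = 24) :
    Reducible (fun i => span ℝ {v i, w i}) := by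
  obtain ⟨σ, h5, hσ⟩ := exists_perm_sorted (s := s) fun i j hi hj hij e =>
    hd i j hij (by rw [h.det2_eq hi hj, e, sub_self, zero_mul, neg_zero])
  have hn : ∀ i, i ≠ 5 → σ i ≠ 5 := fun i hi h => hi (σ.injective (h.trans h5.symm))
  have h' : DisjointChart (v ∘ σ) (w ∘ σ) (s ∘ σ) (p ∘ σ) (q ∘ σ) :=
    ⟨fun j hj => h.v_eq _ (hn j hj), fun j hj => h.w_eq _ (hn j hj), by simp [h5, h.v_five],
      by simp [h5, h.w_five]⟩
  refine Reducible.of_comp_perm σ (h'.reducible_of_sorted (fun i j hij =>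
    hd _ _ (σ.injective.ne hij)) (fun r => ?_) hσ)
  exact tripleSum_comp_perm (fun i j => det2 (v i) (w i) (v j) (w j)) σ r ▸ hsig (σ r)

lemma SecantChart.reducible {v w : Fin 6 → V4} {s f q : Fin 6 → ℝ}
    (h : SecantChart v w s f q)
    (hd : ∀ i j, i ≠ j → det2 (v i) (w i) (v j) (w j) ≠ 0)
    (hsig : ∀ r, |tripleSum (fun i j => det2 (v i) (w i) (v j) (w j)) r| = 12 ∨
      |tripleSum (fun i j => det2 (v i) (w i) (v j) (w j)) r| = 24) :
    Reducible (fun i => span ℝ {v i, w i}) := by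
  obtain ⟨σ, h5, hσ⟩ := exists_perm_sorted (s := s) fun i j hi hj hij e =>
    hd i j hij (by rw [h.det2_eq hi hj, e, sub_self, zero_mul, neg_zero])
  have hn : ∀ i, i ≠ 5 → σ i ≠ 5 := fun i hi h => hi (σ.injective (h.trans h5.symm))
  have h' : SecantChart (v ∘ σ) (w ∘ σ) (s ∘ σ) (f ∘ σ) (q ∘ σ) :=
    ⟨fun j hj => h.v_eq _ (hn j hj), fun j hj => h.w_eq _ (hn j hj), by simp [h5, h.v_five],
      by simp [h5, h.w_five]⟩
  refine Reducible.of_comp_perm σ (h'.reducible_of_sorted (fun i j hij =>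
    hd _ _ (σ.injective.ne hij)) (fun r => ?_) hσ)
  exact tripleSum_comp_perm (fun i j => det2 (v i) (w i) (v j) (w j)) σ r ▸ hsig (σ r)

lemma Skew.map {f : V4 →ₗ[ℝ] V4} (hf : Function.Injective f) {P Q : PLine} (h : Skew P Q) :
    Skew (P.map f) (Q.map f) := by
  refine ⟨(equivMapOfInjective f hf P).finrank_eq.symm.trans h.1,
    (equivMapOfInjective f hf Q).finrank_eq.symm.trans h.2.1, ?_⟩
  rw [← map_inf f hf, h.2.2, Submodule.map_bot]

lemma Reducible.map {L : Fin 6 → PLine} {f : V4 →ₗ[ℝ] V4} (hf : Function.Injective f)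
    (h : Reducible L) : Reducible (fun i => (L i).map f) := by
  obtain ⟨i, j, hij, F, hc, h0, hs, h1, hs1⟩ := h
  have hfc : Continuous f := f.continuous_of_finiteDimensional
  refine ⟨i, j, hij, fun t k => (F t k).map f, fun k => ?_, by simp only [h0],
    fun t ht k l hkl => (hs t ht k l hkl).map hf, congrArg _ h1,
    fun k l hkl a b => (hs1 k l hkl a b).map hf⟩
  obtain ⟨v, w, hv, hw, e⟩ := hc k
  refine ⟨fun t => f (v t), fun t => f (w t), hfc.comp_continuousOn hv, hfc.comp_continuousOn hw,
    fun t ht => ?_⟩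
  have e' : F t k = span ℝ {v t, w t} := e t ht
  simp only [e', map_span, Set.image_pair]

lemma abs_tripleSum_mul (D : Fin 6 → Fin 6 → ℝ) {c : ℝ} (hc : c ≠ 0) (r : Fin 6) :
    |tripleSum (fun i j => D i j * c) r| = |tripleSum D r| := by
  have key : ∀ x, Real.sign (c * x) = Real.sign c * Real.sign x := by
    intro x
    rcases hc.lt_or_gt with h | h <;> rcases lt_trichotomy x 0 with h' | rfl | h'
    · rw [Real.sign_of_pos (mul_pos_of_neg_of_neg h h'), Real.sign_of_neg h', Real.sign_of_neg h]
      norm_num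
    · simp
    · rw [Real.sign_of_neg (mul_neg_of_neg_of_pos h h'), Real.sign_of_pos h', Real.sign_of_neg h]
      norm_num
    · rw [Real.sign_of_neg (mul_neg_of_pos_of_neg h h'), Real.sign_of_neg h', Real.sign_of_pos h]
      norm_num
    · simp
    · rw [Real.sign_of_pos (mul_pos h h'), Real.sign_of_pos h', Real.sign_of_pos h]; norm_num
  have e : tripleSum (fun i j => D i j * c) r = Real.sign c * tripleSum D r := by
    simp only [tripleSum, Finset.mul_sum]
    refine Finset.sum_congr rfl fun i _ => Finset.sum_congr rfl fun j _ =>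
      Finset.sum_congr rfl fun k _ => ?_
    rw [mul_ite, mul_zero, ← key, ← Real.sign_sq_mul hc (c * _)]
    congr 2
    ring
  rw [e, abs_mul]
  rcases hc.lt_or_gt with h | h
  · rw [Real.sign_of_neg h]; norm_num
  · rw [Real.sign_of_pos h]; norm_num

lemma reducible_of_coordinates {L : Fin 6 → PLine} (hL : PairwiseSkew L)
    (hsig : ∀ i : Fin 6, |sgnOf (L ∘ i.succAbove)| = 2 ∨ |sgnOf (L ∘ i.succAbove)| = 4)
    {M : Matrix (Fin 4) (Fin 4) ℝ} (hM : M.det ≠ 0) {v w : Fin 6 → V4}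
    (h : ∀ i, L i = span ℝ {Matrix.vecMul (v i) M, Matrix.vecMul (w i) M})
    (hred : (∀ i j, i ≠ j → det2 (v i) (w i) (v j) (w j) ≠ 0) →
      (∀ r, |tripleSum (fun i j => det2 (v i) (w i) (v j) (w j)) r| = 12 ∨
        |tripleSum (fun i j => det2 (v i) (w i) (v j) (w j)) r| = 24) →
      Reducible (fun i => span ℝ {v i, w i})) : Reducible L := by
  have hd : ∀ i j, i ≠ j → det2 (Matrix.vecMul (v i) M) (Matrix.vecMul (w i) M)
      (Matrix.vecMul (v j) M) (Matrix.vecMul (w j) M) ≠ 0 := by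
    intro i j hij
    rw [← skew_span_iff, ← h, ← h]
    exact hL i j hij
  have hL' : L = fun i => span ℝ {Matrix.vecMul (v i) M, Matrix.vecMul (w i) M} := funext h
  have hf : Function.Injective M.vecMulLinear := Matrix.vecMul_injective_of_isUnit
    ((Matrix.isUnit_iff_isUnit_det M).mpr (isUnit_iff_ne_zero.mpr hM))
  have hr := (hred (fun i j hij h0 => hd i j hij (by rw [det2_vecMul, h0, zero_mul])) fun r => by
    rw [← abs_tripleSum_mul _ hM]
    simp only [← det2_vecMul]
    rw [tripleSum_eq_sgnOf hd, ← hL', abs_mul, abs_of_pos (by norm_num : (0 : ℝ) < 6)]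
    exact (hsig r).imp (fun h => by rw [h]; norm_num) (fun h => by rw [h]; norm_num)).map hf
  rw [hL']
  simpa only [map_span, Set.image_pair, Matrix.vecMulLinear_apply] using hr

lemma IsLine.exists_span_of_mem {P : PLine} (h : IsLine P) {z : V4} (hz : z ∈ P) (h0 : z ≠ 0) :
    ∃ u, P = span ℝ {z, u} := by
  obtain ⟨a, b, rfl⟩ := h.exists_span
  obtain ⟨x, y, rfl⟩ := mem_span_pair.mp hz
  by_cases hx : x = 0
  · have hy : y ≠ 0 := by rintro rfl; simp [hx] at h0
    exact ⟨a, (span_pair_eq (x := x) (y := y) (z := 1) (t := 0) (by simpa using hy) rfl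
      (by simp)).symm⟩
  · exact ⟨b, (span_pair_eq (x := x) (y := y) (z := 0) (t := 1) (by simpa using hx) rfl
      (by simp)).symm⟩

lemma exists_vecMul_span {m1 m2 k1 k2 : V4} (hd : det2 m1 m2 k1 k2 ≠ 0) {P : PLine}
    (hP : IsLine P) {x y : ℝ} (hz : x • m1 + y • m2 ∈ P) (hx : x ≠ 0) :
    ∃ (s : ℝ) (u : V4), P = span ℝ {Matrix.vecMul ![1, s, 0, 0] (Matrix.of ![m1, m2, k1, k2]),
      Matrix.vecMul u (Matrix.of ![m1, m2, k1, k2])} := by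
  have e : Matrix.vecMul ![1, y / x, 0, 0] (Matrix.of ![m1, m2, k1, k2]) =
      x⁻¹ • (x • m1 + y • m2) := by
    rw [vecMul_of_four, smul_add, smul_smul, smul_smul, inv_mul_cancel₀ hx]
    simp [div_eq_inv_mul]
  have h0 : Matrix.vecMul ![1, y / x, 0, 0] (Matrix.of ![m1, m2, k1, k2]) ≠ 0 := by
    rw [vecMul_of_four]
    intro h
    exact one_ne_zero (four_coords_eq_zero hd h).1
  obtain ⟨u, hu⟩ := hP.exists_span_of_mem (e ▸ P.smul_mem x⁻¹ hz) h0
  obtain ⟨a, b, c, d, rfl⟩ := exists_four_coords hd u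
  refine ⟨y / x, ![a, b, c, d], ?_⟩
  rw [hu]
  simp only [vecMul_of_four]
  simp

lemma vecMul_basis (m1 m2 k1 k2 : V4) :
    Matrix.vecMul ![0, 1, 0, 0] (Matrix.of ![m1, m2, k1, k2]) = m2 ∧
    Matrix.vecMul ![0, 0, 1, 0] (Matrix.of ![m1, m2, k1, k2]) = k1 ∧
    Matrix.vecMul ![0, 0, 0, 1] (Matrix.of ![m1, m2, k1, k2]) = k2 := by
  simp only [vecMul_of_four]
  simp

lemma reducible_of_disjoint {L : Fin 6 → PLine} (hL : PairwiseSkew L)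
    (hsig : ∀ i : Fin 6, |sgnOf (L ∘ i.succAbove)| = 2 ∨ |sgnOf (L ∘ i.succAbove)| = 4)
    {m1 m2 : V4} (hm : IsTransversal L m1 m2) (h5 : L 5 ⊓ span ℝ {m1, m2} = ⊥) :
    Reducible L := by
  obtain ⟨k1, k2, hk⟩ := (hL 5 0 (by decide)).1.exists_span
  have hd : det2 m1 m2 k1 k2 ≠ 0 := by
    rw [← skew_span_iff, ← hk]
    exact ⟨hm.1, (hL 5 0 (by decide)).1, by rw [inf_comm, h5]⟩
  have hz : ∀ i, i ≠ 5 → ∃ x y : ℝ, ¬ (x = 0 ∧ y = 0) ∧ x • m1 + y • m2 ∈ L i := by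
    intro i hi
    obtain ⟨z, hz, hz0, hzm⟩ := hm.2 i hi
    obtain ⟨x, y, rfl⟩ := mem_span_pair.mp hzm
    exact ⟨x, y, fun h => hz0 (by simp [h.1, h.2]), hz⟩
  choose! x y hxy hzL using hz
  obtain ⟨c, hc⟩ := Infinite.exists_notMem_finset (Finset.univ.image fun i => x i / y i)
  have hd' : det2 m1 (m2 + c • m1) k1 k2 ≠ 0 := by
    have : det2 m1 (m2 + c • m1) k1 k2 = det2 m1 m2 k1 k2 := by
      simp only [det2_explicit, Pi.add_apply, Pi.smul_apply, smul_eq_mul]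
      ring
    rwa [this]
  set M : Matrix (Fin 4) (Fin 4) ℝ := Matrix.of ![m1, m2 + c • m1, k1, k2] with hM
  have hMd : M.det ≠ 0 := hd'
  have key : ∀ i, i ≠ 5 → ∃ s p q : ℝ, L i =
      span ℝ {Matrix.vecMul ![1, s, 0, 0] M, Matrix.vecMul ![-s, 1, p, q] M} := by
    intro i hi
    have hx : x i - c * y i ≠ 0 := by
      intro h
      by_cases hy : y i = 0
      · exact hxy i hi ⟨by simpa [hy] using h, hy⟩
      · exact hc (Finset.mem_image.mpr ⟨i, Finset.mem_univ _, by
          rw [div_eq_iff hy]; linarith⟩)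
    obtain ⟨s, u, hu⟩ := exists_vecMul_span hd' (hL i 5 hi).1
      (x := x i - c * y i) (y := y i) (by
        have := hzL i hi
        convert this using 1
        module) hx
    have hs := hL i 5 hi
    have hb := vecMul_basis m1 (m2 + c • m1) k1 k2
    rw [← hM] at hu hb
    rw [hu, hk, ← hb.2.1, ← hb.2.2, skew_span_iff, det2_vecMul] at hs
    have he := left_ne_zero_of_mul hs
    rw [det2_explicit] at he
    simp at he
    refine ⟨s, (1 + s ^ 2) / (u 1 - s * u 0) * u 2, (1 + s ^ 2) / (u 1 - s * u 0) * u 3, ?_⟩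
    have hs1 : 1 + s ^ 2 ≠ 0 := by positivity
    rw [hu]
    refine (span_pair_eq (x := 1) (y := 0)
      (z := -s - (1 + s ^ 2) / (u 1 - s * u 0) * u 0) (t := (1 + s ^ 2) / (u 1 - s * u 0))
      (by simpa using ⟨hs1, he⟩) (by simp) ?_).symm
    rw [← Matrix.smul_vecMul, ← Matrix.smul_vecMul, ← Matrix.add_vecMul]
    congr 1
    ext i
    fin_cases i <;> simp
    field_simp
    ring
  choose! s p q h using key
  refine reducible_of_coordinates hL hsig hMd
    (v := fun j => if j = 5 then ![0, 0, 0, 1] else ![1, s j, 0, 0])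
    (w := fun j => if j = 5 then ![0, 0, 1, 0] else ![-s j, 1, p j, q j]) (fun i => ?_)
    (DisjointChart.reducible (s := s) (p := p) (q := q)
      ⟨fun j hj => if_neg hj, fun j hj => if_neg hj, if_pos rfl, if_pos rfl⟩)
  by_cases hi : i = 5
  · subst hi
    have hb := vecMul_basis m1 (m2 + c • m1) k1 k2
    simp only [if_true, hM, hb.2.1, hb.2.2, hk, Set.pair_comm k1]
  · simp only [if_neg hi, h i hi]

lemma reducible_of_secant {L : Fin 6 → PLine} (hL : PairwiseSkew L)
    (hsig : ∀ i : Fin 6, |sgnOf (L ∘ i.succAbove)| = 2 ∨ |sgnOf (L ∘ i.succAbove)| = 4)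
    {m1 m2 : V4} (hm : IsTransversal L m1 m2) (h5 : L 5 ⊓ span ℝ {m1, m2} ≠ ⊥) :
    Reducible L := by
  obtain ⟨n2, ⟨hn5, hnm⟩, hn0⟩ := exists_mem_ne_zero_of_ne_bot h5
  obtain ⟨n1, hn1⟩ := hm.1.exists_span_of_mem hnm hn0
  obtain ⟨k2, hk⟩ := (hL 5 0 (by decide)).1.exists_span_of_mem hn5 hn0
  have hz : ∀ i, i ≠ 5 → ∃ x y : ℝ, x ≠ 0 ∧ x • n1 + y • n2 ∈ L i := by
    intro i hi
    obtain ⟨z, hz, hz0, hzm⟩ := hm.2 i hi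
    rw [hn1] at hzm
    obtain ⟨y, x, rfl⟩ := mem_span_pair.mp hzm
    refine ⟨x, y, ?_, by rwa [add_comm]⟩
    rintro rfl
    apply hz0
    have : y • n2 + (0 : ℝ) • n1 ∈ L i ⊓ L 5 := ⟨hz, by simpa using (L 5).smul_mem y hn5⟩
    rwa [(hL i 5 hi).2.2, mem_bot] at this
  choose! x y hx hzL using hz
  obtain ⟨k1, hk1⟩ : ∃ k1, L 0 = span ℝ {x 0 • n1 + y 0 • n2, k1} := by
    refine (hL 0 5 (by decide)).1.exists_span_of_mem (hzL 0 (by decide)) fun h => ?_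
    have hlin := (isLine_span_pair_iff n2 n1).mp (hn1 ▸ hm.1) (y 0) (x 0) (by rwa [add_comm])
    exact hx 0 (by decide) hlin.2
  have hd : det2 n1 n2 k1 k2 ≠ 0 := by
    have hs := hL 0 5 (by decide)
    rw [hk1, hk, skew_span_iff] at hs
    intro h0
    apply hs
    have : det2 (x 0 • n1 + y 0 • n2) k1 n2 k2 = -(x 0 * det2 n1 n2 k1 k2) := by
      simp only [det2_explicit, Pi.add_apply, Pi.smul_apply, smul_eq_mul]
      ring
    rw [this, h0, mul_zero, neg_zero]
  set M : Matrix (Fin 4) (Fin 4) ℝ := Matrix.of ![n1, n2, k1, k2] with hM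
  have hMd : M.det ≠ 0 := hd
  have hb := vecMul_basis n1 n2 k1 k2
  rw [← hM] at hb
  have key : ∀ i, i ≠ 5 → ∃ s f q : ℝ, L i =
      span ℝ {Matrix.vecMul ![1, s, 0, 0] M, Matrix.vecMul ![0, f, 1, q] M} := by
    intro i hi
    obtain ⟨s, u, hu⟩ := exists_vecMul_span hd (hL i 5 hi).1 (hzL i hi) (hx i hi)
    have hs := hL i 5 hi
    rw [← hM] at hu
    rw [hu, hk, ← hb.1, ← hb.2.2, skew_span_iff, det2_vecMul] at hs
    have he := left_ne_zero_of_mul hs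
    rw [det2_explicit] at he
    simp at he
    refine ⟨s, (u 2)⁻¹ * (u 1 - s * u 0), (u 2)⁻¹ * u 3, ?_⟩
    rw [hu]
    refine (span_pair_eq (x := 1) (y := 0) (z := -((u 2)⁻¹ * u 0)) (t := (u 2)⁻¹)
      (by simpa using he) (by simp) ?_).symm
    rw [← Matrix.smul_vecMul, ← Matrix.smul_vecMul, ← Matrix.add_vecMul]
    congr 1
    ext i
    fin_cases i <;> simp [he]
    ring
  choose! s f q h using key
  refine reducible_of_coordinates hL hsig hMd
    (v := fun j => if j = 5 then ![0, 1, 0, 0] else ![1, s j, 0, 0])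
    (w := fun j => if j = 5 then ![0, 0, 0, 1] else ![0, f j, 1, q j]) (fun i => ?_)
    (SecantChart.reducible (s := s) (f := f) (q := q)
      ⟨fun j hj => if_neg hj, fun j hj => if_neg hj, if_pos rfl, if_pos rfl⟩)
  by_cases hi : i = 5
  · subst hi
    simp only [if_true, hb.1, hb.2.2, hk]
  · simp only [if_neg hi, h i hi]

theorem schlafli_bipartite_tripartite_reducible (L : Fin 6 → PLine) (hL : IsSchlafliSix L)
    (hsig : ∀ i : Fin 6, |sgnOf (L ∘ i.succAbove)| = 2 ∨ |sgnOf (L ∘ i.succAbove)| = 4) :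
    Reducible L := by
  obtain ⟨m1, m2, hm⟩ := hL.exists_transversal
    (by rcases hsig 5 with h | h <;> rw [h] <;> norm_num)
  by_cases h5 : L 5 ⊓ span ℝ {m1, m2} = ⊥
  · exact reducible_of_disjoint hL.1 hsig hm h5
  · exact reducible_of_secant hL.1 hsig hm h5
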